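/- arXiv:2010.13079 — 2 statements merged into one kernel-verified Lean document; each statement's English description precedes it below -/
import Mathlib

section
/- Let q = p^e be a power of a prime with q ≡ 1 (mod 6), t = (q-1)/6, ω₆ = ω^t, ω₃ = ω^{2t}, ω₂ = ω^{3t}, and let λ ∈ 𝔽_q with λ ≠ 0 and λ⁶ ≠ 1. For the equivalence class of w = (0,0,0,3,4,5): Σ_{w'∈[0,0,0,3,4,5]} N_q(0,w') + S_{[0,0,0,3,4,5]} = −q²·J(ω₂,ω̄₃,ω̄₆)·₂F₁(ω̄₃,ω̄₆; ε | 1/λ⁶)_q. -/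
open scoped Classical

noncomputable section

/-- The Gauss sum `g(χ) = ∑ₓ χ(x) exp(2π√-1 · tr(x)/p)` of a multiplicative character `χ`
of a finite field `F` of characteristic `p`, where `tr : F → 𝔽_p` is the trace map. -/
def gaussChar (p : ℕ) (F : Type) [Field F] [Fintype F] [Algebra (ZMod p) F]
    (χ : MulChar F ℂ) : ℂ :=
  ∑ x : F, χ x *
    Complex.exp (2 * Real.pi * Complex.I * ((Algebra.trace (ZMod p) F x).val : ℂ) / (p : ℂ))

/-- The Jacobi sum `J(χ₁, …, χₙ) = ∑_{x₁ + ⋯ + xₙ = 1} χ₁(x₁) ⋯ χₙ(xₙ)`. -/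
def jacobiS (F : Type) [Field F] [Fintype F] {n : ℕ} (χ : Fin n → MulChar F ℂ) : ℂ :=
  ∑ v ∈ Finset.univ.filter (fun v : Fin n → F => ∑ i, v i = 1), ∏ i, χ i (v i)

/-- The normalized Jacobi sum `binom(A; B) = (B(-1)/q) · J(A, B̄)`. -/
def gBinom (F : Type) [Field F] [Fintype F] (A B : MulChar F ℂ) : ℂ :=
  B (-1) / (Fintype.card F : ℂ) * jacobiS F ![A, B⁻¹]

/-- Greene's finite-field hypergeometric function `ₙ₊₁Fₙ` (case `n ≥ 2`), where the sum over all
multiplicative characters is written as a sum over the powers `ω^j`, `0 ≤ j ≤ q - 2`, of a fixed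
generator `ω` of the character group. -/
def greeneF (F : Type) [Field F] [Fintype F] (ω : MulChar F ℂ) {n : ℕ}
    (A : Fin (n + 1) → MulChar F ℂ) (B : Fin n → MulChar F ℂ) (x : F) : ℂ :=
  (Fintype.card F : ℂ) / ((Fintype.card F : ℂ) - 1) *
    ∑ j ∈ Finset.range (Fintype.card F - 1),
      gBinom F (A 0 * ω ^ j) (ω ^ j) *
        (∏ i : Fin n, gBinom F (A i.succ * ω ^ j) (B i * ω ^ j)) * (ω ^ j) x

/-- Greene's finite-field hypergeometric function `₂F₁` (case `n = 1`):
`₂F₁(A₀, A₁; B₁ | x) = ε(x) · (A₁B₁(-1)/q) · ∑_y A₁(y) (A̅₁B₁)(1-y) A̅₀(1-xy)`. -/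
def greene2F1 (F : Type) [Field F] [Fintype F] (A₀ A₁ B₁ : MulChar F ℂ) (x : F) : ℂ :=
  (1 : MulChar F ℂ) x * ((A₁ * B₁) (-1) / (Fintype.card F : ℂ)) *
    ∑ y : F, A₁ y * (A₁⁻¹ * B₁) (1 - y) * A₀⁻¹ (1 - x * y)

/-- The number of `F`-rational points of the Dwork hypersurface
`x₁^d + ⋯ + x_d^d = dλ x₁ ⋯ x_d` in projective space. -/
def dworkCount (F : Type) [Field F] [Fintype F] (d : ℕ) (lam : F) : ℕ :=
  Nat.card {P : Projectivization F (Fin d → F) //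
    ∑ i, P.rep i ^ d = (d : F) * lam * ∏ i, P.rep i}

/-- The number of `F`-rational points of the diagonal hypersurface
`x₁^d + ⋯ + xₙ^d = dλ x₁^{h₁} ⋯ xₙ^{hₙ}` in projective space. -/
def diagCount (F : Type) [Field F] [Fintype F] (d n : ℕ) (h : Fin n → ℕ) (lam : F) : ℕ :=
  Nat.card {P : Projectivization F (Fin n → F) //
    ∑ i, P.rep i ^ d = (d : F) * lam * ∏ i, P.rep i ^ h i}

/-- The quantity `N_q(0, w)` from Koblitz's formula, with `t = (q - 1)/d`. -/
def NqW (p : ℕ) (F : Type) [Field F] [Fintype F] [Algebra (ZMod p) F]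
    (ω : MulChar F ℂ) (d : ℕ) {n : ℕ} (w : Fin n → ZMod d) : ℂ :=
  if ∀ i, w i = 0 then ((Fintype.card F : ℂ) ^ (n - 1) - 1) / ((Fintype.card F : ℂ) - 1)
  else if ∀ i, w i ≠ 0 then
    (1 / (Fintype.card F : ℂ)) *
      ∏ i, gaussChar p F (ω ^ ((w i).val * ((Fintype.card F - 1) / d)))
  else 0

/-- The quantity `S_{[w]} = (q-1)⁻¹ ∑_{j=0}^{q-2} (∏ᵢ g(ω^{wᵢt + hᵢj}) / g(ω^{dj})) ω^{dj}(dλ)`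
from Koblitz's formula, with `t = (q - 1)/d`. -/
def SW (p : ℕ) (F : Type) [Field F] [Fintype F] [Algebra (ZMod p) F]
    (ω : MulChar F ℂ) (d : ℕ) {n : ℕ} (h : Fin n → ℕ) (w : Fin n → ZMod d) (lam : F) : ℂ :=
  ((Fintype.card F : ℂ) - 1)⁻¹ *
    ∑ j ∈ Finset.range (Fintype.card F - 1),
      (∏ i, gaussChar p F (ω ^ ((w i).val * ((Fintype.card F - 1) / d) + h i * j))) /
          gaussChar p F (ω ^ (d * j)) * (ω ^ (d * j)) ((d : F) * lam)

end

lemma aux_ringhelp {F : Type} [Field F] [Fintype F] (ω : MulChar F ℂ)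
    (hω : ∀ χ : MulChar F ℂ, ∃ j : ℕ, χ = ω ^ j) {x : F} (h : ω x = 1) : x = 1 := by
  by_contra hx
  obtain ⟨χ, hχ⟩ := MulChar.exists_apply_ne_one_of_hasEnoughRootsOfUnity F ℂ hx
  obtain ⟨j, rfl⟩ := hω χ
  apply hχ
  have hx0 : x ≠ 0 := by rintro rfl; rw [MulChar.map_zero] at h; exact zero_ne_one h
  have : IsUnit x := hx0.isUnit
  obtain ⟨u, rfl⟩ := this
  rw [MulChar.pow_apply_coe, h, one_pow]

lemma aux_gen (F : Type) [Field F] [Fintype F] : ∃ g : F, g ≠ 0 ∧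
    (∀ c : F, c ≠ 0 → ∃ k : ℕ, c = g ^ k) ∧ ∀ k : ℕ, g ^ k = 1 → (Fintype.card F - 1) ∣ k := by
  obtain ⟨g, hg⟩ := IsCyclic.exists_generator (α := Fˣ)
  refine ⟨g, g.ne_zero, ?_, ?_⟩
  · intro c hc
    obtain ⟨k, hk⟩ := (mem_powers_iff_mem_zpowers (x := g)).2 (hg (Units.mk0 c hc))
    exact ⟨k, by have := congrArg Units.val hk; simpa using this.symm⟩
  · intro k hk
    have h1 : orderOf g = Fintype.card F - 1 := by
      rw [orderOf_eq_card_of_forall_mem_zpowers hg, Nat.card_eq_fintype_card, Fintype.card_units]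
    rw [← h1]
    apply orderOf_dvd_of_pow_eq_one
    ext; simpa using hk

lemma aux_order {F : Type} [Field F] [Fintype F] (ω : MulChar F ℂ)
    (hω : ∀ χ : MulChar F ℂ, ∃ j : ℕ, χ = ω ^ j) (n : ℕ) (h : ω ^ n = 1) :
    (Fintype.card F - 1) ∣ n := by
  obtain ⟨g, hg0, -, hg⟩ := aux_gen F
  apply hg
  apply aux_ringhelp ω hω
  obtain ⟨u, rfl⟩ : IsUnit g := hg0.isUnit
  rw [map_pow, ← MulChar.pow_apply_coe, h, MulChar.one_apply_coe]

lemma aux_pow_card {F : Type} [Field F] [Fintype F] (ω : MulChar F ℂ) :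
    ω ^ (Fintype.card F - 1) = 1 := by
  ext u
  rw [MulChar.pow_apply_coe, ← map_pow, MulChar.one_apply_coe, 
    FiniteField.pow_card_sub_one_eq_one _ u.ne_zero, map_one]

lemma aux_root {F : Type} [Field F] [Fintype F] (ω : MulChar F ℂ)
    (hω : ∀ χ : MulChar F ℂ, ∃ j : ℕ, χ = ω ^ j) (n m : ℕ) (hnm : n * m = Fintype.card F - 1)
    {c : F} (hc : c ≠ 0) (h : (ω ^ m) c = 1) : ∃ d, d ^ n = c := by
  obtain ⟨g, hg0, hg1, hg⟩ := aux_gen F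
  obtain ⟨k, rfl⟩ := hg1 c hc
  have h1 : g ^ (k * m) = 1 := by
    apply aux_ringhelp ω hω
    obtain ⟨u, rfl⟩ : IsUnit g := hg0.isUnit
    rw [← Units.val_pow_eq_pow_val, MulChar.pow_apply_coe, Units.val_pow_eq_pow_val] at h
    rw [pow_mul, map_pow, h]
  have h2 := hg _ h1
  rw [← hnm] at h2
  have hm : 0 < m := by
    rcases Nat.eq_zero_or_pos m with rfl | h
    · have := Fintype.one_lt_card (α := F); omega
    · exact h
  obtain ⟨l, rfl⟩ := Nat.dvd_of_mul_dvd_mul_right hm h2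
  exact ⟨g ^ l, by rw [← pow_mul, mul_comm]⟩

/-- count of cube roots -/
lemma aux_cuberoots {F : Type} [Field F] [Fintype F] (ρ : MulChar F ℂ) (h3 : ρ ^ 3 = 1)
    (hcube : ∀ c : F, c ≠ 0 → ρ c = 1 → ∃ d, d ^ 3 = c) (ζ : F) (hζ : ζ ^ 2 + ζ + 1 = 0)
    (hF3 : (3 : F) ≠ 0) (c : F) (hc : c ≠ 0) :
    ((Finset.univ.filter (fun α : F => α ^ 3 = c)).card : ℂ) = 1 + ρ c + ρ c ^ 2 := by
  have hρ3 : ρ c ^ 3 = 1 := by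
    obtain ⟨u, rfl⟩ : IsUnit c := hc.isUnit
    rw [← MulChar.pow_apply_coe, h3, MulChar.one_apply_coe]
  by_cases h : ρ c = 1
  · obtain ⟨d, rfl⟩ := hcube c hc h
    have hd : d ≠ 0 := by rintro rfl; simp at hc
    have hz1 : ζ ≠ 1 := by rintro rfl; apply hF3; linear_combination hζ
    have hz0 : ζ ≠ 0 := by rintro rfl; simp at hζ
    have hz2 : ζ ^ 2 ≠ 1 := by
      intro h; apply hz1
      have : ζ = -2 := by linear_combination hζ - h
      subst this
      exact absurd (by linear_combination h) hF3
    have : (Finset.univ.filter (fun α : F => α ^ 3 = d ^ 3)) = {d, ζ * d, ζ ^ 2 * d} := by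
      ext α
      simp only [Finset.mem_filter, Finset.mem_univ, true_and, Finset.mem_insert,
        Finset.mem_singleton]
      constructor
      · intro h
        have : (α - d) * ((α - ζ * d) * (α - ζ ^ 2 * d)) = 0 := by
          linear_combination h - (α - d) * α * d * hζ + (α - d) * d ^ 2 * (ζ - 1) * hζ
        rcases mul_eq_zero.1 this with h | h
        · left; linear_combination h
        rcases mul_eq_zero.1 h with h | h
        · right; left; linear_combination h
        · right; right; linear_combination h
      · rintro (rfl | rfl | rfl)
        · rfl
        · linear_combination d ^ 3 * (ζ - 1) * hζ
        · linear_combination d ^ 3 * (ζ ^ 3 + 1) * (ζ - 1) * hζ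
    rw [this, h, Finset.card_insert_of_notMem, Finset.card_insert_of_notMem, Finset.card_singleton]
    · norm_num
    · simp only [Finset.mem_singleton]
      intro h
      have := mul_right_cancel₀ hd h
      apply hz1
      have : ζ * (ζ - 1) = 0 := by linear_combination - this
      rcases mul_eq_zero.1 this with h | h
      · exact absurd h hz0
      · linear_combination h
    · simp only [Finset.mem_insert, Finset.mem_singleton, not_or]
      constructor
      · intro h
        exact hz1 (mul_right_cancel₀ hd (by rw [one_mul]; exact h.symm))
      · intro h
        exact hz2 (mul_right_cancel₀ hd (by rw [one_mul]; exact h.symm))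
  · have : Finset.univ.filter (fun α : F => α ^ 3 = c) = ∅ := by
      ext α
      simp only [Finset.mem_filter, Finset.mem_univ, true_and, Finset.notMem_empty, iff_false]
      rintro rfl
      apply h
      have hα : α ≠ 0 := by rintro rfl; simp at hc
      obtain ⟨u, rfl⟩ : IsUnit α := hα.isUnit
      rw [map_pow, ← MulChar.pow_apply_coe, h3, MulChar.one_apply_coe]
    rw [this]
    have h' : (ρ c - 1) * (1 + ρ c + ρ c ^ 2) = 0 := by linear_combination hρ3
    rcases mul_eq_zero.1 h' with h1 | h1
    · exact absurd (by linear_combination h1) h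
    · simp [h1]

lemma aux_bij {F : Type} [Field F] [Fintype F] (hF3 : (3 : F) ≠ 0) (x : F) (hx : x ≠ 0)
    (hx1 : x ≠ 1) (hd : 2 * x ≠ 1) :
    (Finset.univ.filter (fun y : F => y ^ 3 - 3 * (x * (1 - x)) * y + x * (1 - x) = 0)).card =
    (Finset.univ.filter (fun α : F => α ^ 3 = - (x * (1 - x)) * x)).card := by
  have hx1' : 1 - x ≠ 0 := sub_ne_zero.2 hx1.symm
  obtain ⟨a, ha⟩ : ∃ a, a = x * (1 - x) := ⟨_, rfl⟩
  have ha0 : a ≠ 0 := by rw [ha]; exact mul_ne_zero hx hx1'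
  rw [← ha]
  have hd' : (2 * x - 1) ^ 2 ≠ 0 := pow_ne_zero _ (sub_ne_zero.2 hd)
  have key : ∀ y : F, y ^ 3 - 3 * a * y + a = 0 → y ≠ x ∧ y ^ 2 - a ≠ 0 := by
    intro y hy
    constructor
    · rintro rfl
      have : y * (2 * y - 1) ^ 2 = 0 := by rw [ha] at hy; linear_combination hy
      simp_all
    · intro h
      have h1 : a * (2 * y - 1) = 0 := by linear_combination - hy + y * h
      have h2 : 2 * y - 1 = 0 := by simpa [ha0] using h1
      apply hd'
      linear_combination -(2 * y + 1) * h2 + 4 * h + 4 * ha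
  have key2 : ∀ α : F, α ^ 3 = -a * x → α ≠ 0 := by
    rintro α hα rfl
    have : a * x = 0 := by linear_combination hα
    simp_all
  have key3 : ∀ y : F, y ^ 3 - 3 * a * y + a = 0 → 
      (a * (y - x) / (y ^ 2 - a)) ≠ 0 ∧ 
      (a * (y - x) / (y ^ 2 - a)) ^ 2 - y * (a * (y - x) / (y ^ 2 - a)) + a = 0 ∧
      (a * (y - x) / (y ^ 2 - a)) ^ 3 = -a * x := by
    intro y hy
    obtain ⟨h1, h2⟩ := key y hy
    obtain ⟨α, hα⟩ : ∃ α, α = a * (y - x) / (y ^ 2 - a) := ⟨_, rfl⟩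
    rw [← hα]
    have hα' : α * (y ^ 2 - a) = a * (y - x) := by rw [hα]; field_simp
    have h4 : α ^ 2 - y * α + a = 0 := by
      have : (α ^ 2 - y * α + a) * (y ^ 2 - a) ^ 2 = 0 := by
        linear_combination (α * (y ^ 2 - a) + a * (y - x) - y * (y ^ 2 - a)) * hα' +
          a * x * hy + (a^2) * ha
      rcases mul_eq_zero.1 this with h | h
      · exact h
      · exact absurd h (pow_ne_zero _ h2)
    refine ⟨?_, h4, ?_⟩
    · rw [hα]
      exact div_ne_zero (mul_ne_zero ha0 (sub_ne_zero.2 h1)) h2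
    · linear_combination (α + y) * h4 + hα'
  have key4 : ∀ α : F, α ^ 3 = -a * x → (α + a / α) ^ 3 - 3 * a * (α + a / α) + a = 0 := by
    intro α hα
    have h0 := key2 α hα
    obtain ⟨β, hβ⟩ : ∃ β, β = a / α := ⟨_, rfl⟩
    rw [← hβ]
    have hab : α * β = a := by rw [hβ]; field_simp
    have hb3 : β ^ 3 = - a * (1 - x) := by
      have : (β ^ 3 + a * (1 - x)) * (a * x) = 0 := by
        linear_combination β ^ 3 * hα - ((α * β) ^ 2 + α * β * a + a ^ 2) * hab - a ^ 2 * ha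
      rcases mul_eq_zero.1 this with h | h
      · linear_combination h
      · exact absurd h (mul_ne_zero ha0 hx)
    linear_combination hα + hb3 + 3 * (α + β) * hab
  symm
  refine Finset.card_bij' (s := Finset.univ.filter (fun α : F => α ^ 3 = -a * x))
    (t := Finset.univ.filter (fun y : F => y ^ 3 - 3 * a * y + a = 0))
    (fun α _ => α + a / α)
    (fun y _ => a * (y - x) / (y ^ 2 - a)) ?_ ?_ ?_ ?_
  · intro α hα
    simp only [Finset.mem_filter, Finset.mem_univ, true_and] at hα ⊢
    exact key4 α hα
  · intro y hy
    simp only [Finset.mem_filter, Finset.mem_univ, true_and] at hy ⊢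
    exact (key3 y hy).2.2
  · intro α hα
    simp only [Finset.mem_filter, Finset.mem_univ, true_and] at hα ⊢
    have h0 := key2 α hα
    obtain ⟨h1, h2⟩ := key _ (key4 α hα)
    rw [div_eq_iff h2]
    have hy : α * (α + a / α) = α ^ 2 + a := by field_simp
    generalize α + a / α = y at *
    linear_combination -hα - (y + α) * hy
  · intro y hy
    simp only [Finset.mem_filter, Finset.mem_univ, true_and] at hy ⊢
    obtain ⟨h1, h2, h3⟩ := key3 y hy
    generalize a * (y - x) / (y ^ 2 - a) = α at *
    field_simp
    linear_combination h2

lemma aux_sumM {F : Type} [Field F] [Fintype F] (hF3 : (3 : F) ≠ 0) (χ : MulChar F ℂ) :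
    ∑ b : F, χ b * ((Finset.univ.filter (fun y : F => y ^ 3 - 3 * b * y + b = 0)).card : ℂ) =
      ∑ y : F, χ (y ^ 3 / (3 * y - 1)) := by
  simp_rw [Finset.card_filter, Nat.cast_sum, Finset.mul_sum]
  rw [Finset.sum_comm]
  refine Finset.sum_congr rfl fun y _ => ?_
  by_cases hy : 3 * y - 1 = 0
  · rw [hy, div_zero, MulChar.map_zero]
    apply Finset.sum_eq_zero
    intro b _
    rw [if_neg, Nat.cast_zero, mul_zero]
    intro h
    have : y ^ 3 = 0 := by linear_combination h + b * hy
    have := pow_eq_zero_iff (three_ne_zero) |>.1 this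
    subst this
    simp at hy
  · rw [Finset.sum_eq_single (y ^ 3 / (3 * y - 1))]
    · rw [if_pos, Nat.cast_one, mul_one]
      have hb := div_mul_cancel₀ (y ^ 3) hy
      linear_combination -hb
    · intro b _ hb
      rw [if_neg, Nat.cast_zero, mul_zero]
      intro h
      apply hb
      rw [eq_div_iff hy]
      linear_combination -h
    · simp

lemma aux_sumJ {F : Type} [Field F] [Fintype F] (χ ρ : MulChar F ℂ) :
    ∑ b : F, χ b * ∑ x ∈ Finset.univ.filter (fun x : F => x * (1 - x) = b), ρ x =
      jacobiSum (χ * ρ) χ := by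
  simp_rw [Finset.sum_filter, Finset.mul_sum]
  rw [Finset.sum_comm, jacobiSum]
  refine Finset.sum_congr rfl fun x _ => ?_
  rw [Finset.sum_eq_single (x * (1 - x))]
  · rw [if_pos rfl, map_mul, MulChar.mul_apply]; ring
  · intro b _ hb
    rw [if_neg hb.symm, mul_zero]
  · simp

lemma aux_M {F : Type} [Field F] [Fintype F] (ρ : MulChar F ℂ) (h3 : ρ ^ 3 = 1) (h1 : ρ ≠ 1)
    (hcube : ∀ c : F, c ≠ 0 → ρ c = 1 → ∃ d, d ^ 3 = c) (ζ : F) (hζ : ζ ^ 2 + ζ + 1 = 0)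
    (hF2 : (2 : F) ≠ 0) (hF3 : (3 : F) ≠ 0) (a : F) (ha : a ≠ 0) :
    ((Finset.univ.filter (fun y : F => y ^ 3 - 3 * a * y + a = 0)).card : ℂ) =
      1 + ρ a * ∑ x ∈ Finset.univ.filter (fun x : F => x * (1 - x) = a), ρ x := by
  have hu3 : ∀ c : F, c ≠ 0 → ρ c ^ 3 = 1 := by
    intro c hc
    obtain ⟨u, rfl⟩ : IsUnit c := hc.isUnit
    rw [← MulChar.pow_apply_coe, h3, MulChar.one_apply_coe]
  have hneg : ρ (-1) = 1 := by
    have := hu3 (-1) (by simp)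
    rw [← map_pow] at this
    rw [← this]; congr 1; ring
  have hsq : ∀ x : F, x ≠ 0 → x ≠ 1 → 
    ((Finset.univ.filter (fun y : F => y ^ 3 - 3 * (x * (1 - x)) * y + x * (1 - x) = 0)).card : ℂ) =
      1 + ρ (x * (1 - x)) * 
        ∑ z ∈ Finset.univ.filter (fun z : F => z * (1 - z) = x * (1 - x)), ρ z := by
    intro x hx hx1
    have hx1' : 1 - x ≠ 0 := sub_ne_zero.2 hx1.symm
    have hfil : Finset.univ.filter (fun z : F => z * (1 - z) = x * (1 - x)) = {x, 1 - x} := by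
      ext z
      simp only [Finset.mem_filter, Finset.mem_univ, true_and, Finset.mem_insert,
        Finset.mem_singleton]
      constructor
      · intro h
        have : (z - x) * (z - (1 - x)) = 0 := by linear_combination -h
        rcases mul_eq_zero.1 this with h | h
        · left; linear_combination h
        · right; linear_combination h
      · rintro (rfl | rfl) <;> ring
    rw [hfil]
    by_cases hd : 2 * x = 1
    · have hx2 : 1 - x = x := by linear_combination -hd
      rw [hx2]
      have : Finset.univ.filter (fun y : F => y ^ 3 - 3 * (x * x) * y + x * x = 0) = {x, -1} := by
        ext z
        simp only [Finset.mem_filter, Finset.mem_univ, true_and, Finset.mem_insert,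
          Finset.mem_singleton]
        constructor
        · intro h
          have : (z - x) ^ 2 * (z + 1) = 0 := by
            linear_combination h + (-z^2 + 2 * x * z + z * x) * hd - z * x * hd 
          rcases mul_eq_zero.1 this with h | h
          · left
            have := pow_eq_zero_iff (two_ne_zero) |>.1 h
            linear_combination this
          · right; linear_combination h
        · rintro (rfl | rfl)
          · linear_combination -z ^ 2 * hd
          · linear_combination (2 * x + 1) * hd
      rw [this, Finset.pair_eq_singleton, Finset.sum_singleton, map_mul,
        show ρ x * ρ x * ρ x = ρ x ^ 3 by ring, hu3 x hx, Finset.card_pair]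
      · norm_num
      · rintro rfl; apply hF3; linear_combination -hd
    · rw [aux_bij hF3 x hx hx1 hd, aux_cuberoots ρ h3 hcube ζ hζ hF3 _ 
        (mul_ne_zero (neg_ne_zero.2 (mul_ne_zero hx hx1')) hx), Finset.sum_pair,
        show -(x * (1 - x)) * x = (-1) * (x * x * (1 - x)) by ring]
      · simp only [map_mul, hneg]
        linear_combination (ρ x * ρ (1 - x) ^ 2) * hu3 x hx
      · intro h; apply hd; linear_combination h
  by_cases hx : ∃ x, x * (1 - x) = a
  · obtain ⟨x, rfl⟩ := hx
    exact hsq x (by rintro rfl; simp at ha) (by rintro rfl; simp at ha)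
  -- counting
  have hle : ∀ b : F, b ≠ 0 → (¬ ∃ x, x * (1 - x) = b) → 
      (Finset.univ.filter (fun y : F => y ^ 3 - 3 * b * y + b = 0)).card ≤ 1 := by
    intro b hb hnx
    rw [Finset.card_le_one]
    intro u hu v hv
    simp only [Finset.mem_filter, Finset.mem_univ, true_and] at hu hv
    by_contra huv
    apply hnx
    have huv' : u - v ≠ 0 := sub_ne_zero.2 huv
    have e1 : u ^ 2 + u * v + v ^ 2 = 3 * b := by
      apply mul_left_cancel₀ huv'
      linear_combination hu - hv
    have e2 : u * v * (u + v) = b := by linear_combination -hu + u * e1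
    obtain ⟨D, hD⟩ : ∃ D, D = (u - v) * (2 * u + v) * (u + 2 * v) := ⟨_, rfl⟩
    have hDD : D ^ 2 = 27 * b ^ 2 * (4 * b - 1) := by
      have : D ^ 2 = 4 * (u ^ 2 + u * v + v ^ 2) ^ 3 - 27 * (u * v * (u + v)) ^ 2 := by
        rw [hD]; ring
      rw [this, e1, e2]; ring
    have hs : (2 * ζ + 1) ^ 2 = -3 := by linear_combination 4 * hζ
    have hF9 : (9 : F) ≠ 0 := by 
      have := mul_ne_zero hF3 hF3
      norm_num at this; exact this
    refine ⟨(1 + (2 * ζ + 1) * D / (9 * b)) / 2, ?_⟩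
    have : ((2 * ζ + 1) * D / (9 * b)) ^ 2 = 1 - 4 * b := by
      rw [div_pow, mul_pow, hs, hDD]; field_simp; ring
    generalize (2 * ζ + 1) * D / (9 * b) = s at *
    field_simp
    linear_combination -this
  let M : F → ℕ := fun b => (Finset.univ.filter (fun y : F => y ^ 3 - 3 * b * y + b = 0)).card
  let R : F → ℂ := fun b => 1 + ρ b * ∑ x ∈ Finset.univ.filter (fun x : F => x * (1 - x) = b), ρ x
  have hR : ∀ b : F, (¬ ∃ x, x * (1 - x) = b) → R b = 1 := by
    intro b hb
    have : Finset.univ.filter (fun x : F => x * (1 - x) = b) = ∅ := by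
      ext x
      simp only [Finset.mem_filter, Finset.mem_univ, true_and, Finset.notMem_empty, iff_false]
      exact fun h => hb ⟨x, h⟩
    simp [R, this]
  have hcard : (∑ b : F, (1 : MulChar F ℂ) b) = Fintype.card F - 1 := by
    rw [MulChar.sum_one_eq_card_units, Fintype.card_units, Nat.cast_sub Fintype.card_pos]
    simp
  have hsumM : ∑ b : F, (1 : MulChar F ℂ) b * (M b : ℂ) = Fintype.card F - 2 := by
    rw [aux_sumM hF3]
    have : ∀ y : F, (1 : MulChar F ℂ) (y ^ 3 / (3 * y - 1)) = 
        (1 : MulChar F ℂ) (3 * y) * (1 : MulChar F ℂ) (1 - 3 * y) := by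
      intro y
      rw [← map_mul]
      by_cases hy : y = 0
      · simp [hy]
      by_cases hy1 : 3 * y = 1
      · simp [hy1]
      have e1 : 3 * y - 1 ≠ 0 := sub_ne_zero.2 hy1
      have e2 : 1 - 3 * y ≠ 0 := sub_ne_zero.2 (Ne.symm hy1)
      rw [MulChar.one_apply (by simp [hy, e1]), MulChar.one_apply (by simp [hy, hF3, e2])]
    simp_rw [this]
    rw [← jacobiSum_one_one, jacobiSum]
    exact Fintype.sum_bijective _ (mulLeft_bijective₀ 3 hF3) _ _ fun x => rfl
  have hsumR : ∑ b : F, (1 : MulChar F ℂ) b * R b = Fintype.card F - 2 := by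
    have : ∀ b : F, (1 : MulChar F ℂ) b * R b = (1 : MulChar F ℂ) b + 
        ρ b * ∑ x ∈ Finset.univ.filter (fun x : F => x * (1 - x) = b), ρ x := by
      intro b
      have : (1 : MulChar F ℂ) b * ρ b = ρ b := by rw [← MulChar.mul_apply, one_mul]
      simp only [R]
      rw [mul_add, ← mul_assoc, this, mul_one]
    simp_rw [this]
    rw [Finset.sum_add_distrib, hcard, aux_sumJ, jacobiSum_comm,
      show ρ * ρ = ρ⁻¹ from eq_inv_of_mul_eq_one_left (by rw [← h3, pow_succ, pow_two]),
      jacobiSum_nontrivial_inv h1, hneg]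
    ring
  have hz : ∑ b : F, (if b ≠ 0 ∧ ¬ ∃ x, x * (1 - x) = b then 1 - M b else 0 : ℕ) = 0 := by
    have : ((∑ b : F, (if b ≠ 0 ∧ ¬ ∃ x, x * (1 - x) = b then 1 - M b else 0 : ℕ) : ℕ) : ℂ) = 0 := by
      rw [← sub_eq_zero.2 (hsumR.trans hsumM.symm), ← Finset.sum_sub_distrib, Nat.cast_sum]
      refine Finset.sum_congr rfl fun b _ => ?_
      by_cases hb : b = 0
      · subst hb
        rw [MulChar.map_zero]; simp
      rw [MulChar.one_apply (isUnit_iff_ne_zero.2 hb)]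
      by_cases hx : ∃ x, x * (1 - x) = b
      · rw [if_neg (fun h => h.2 hx)]
        obtain ⟨x, rfl⟩ := hx
        have := hsq x (by rintro rfl; simp at hb) (by rintro rfl; simp at hb)
        simp only [M, R, this]; simp
      · rw [if_pos ⟨hb, hx⟩, hR b hx, Nat.cast_sub (show M b ≤ 1 from hle b hb hx)]
        simp
    exact_mod_cast this
  have hz' := Finset.sum_eq_zero_iff.1 hz a (Finset.mem_univ _)
  rw [if_pos ⟨ha, hx⟩] at hz'
  have hM1 : M a = 1 := le_antisymm (hle a ha hx) (by omega)
  have := hR a hx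
  change ((M a : ℕ) : ℂ) = R a
  rw [hM1, this]; simp

/-- cubic Jacobi sum identity -/
lemma aux_J3 {F : Type} [Field F] [Fintype F] (ρ : MulChar F ℂ) (h3 : ρ ^ 3 = 1) (h1 : ρ ≠ 1)
    (hcube : ∀ c : F, c ≠ 0 → ρ c = 1 → ∃ d, d ^ 3 = c) (ζ : F) (hζ : ζ ^ 2 + ζ + 1 = 0)
    (hF2 : (2 : F) ≠ 0) (hF3 : (3 : F) ≠ 0) (A : MulChar F ℂ) (hA : A ≠ ρ) :
    A 27 * jacobiSum A (A * ρ) = A (-1) * jacobiSum (A ^ 3) (A⁻¹ * ρ) := by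
  have hu3 : ∀ c : F, c ≠ 0 → ρ c ^ 3 = 1 := by
    intro c hc
    obtain ⟨u, rfl⟩ : IsUnit c := hc.isUnit
    rw [← MulChar.pow_apply_coe, h3, MulChar.one_apply_coe]
  have hneg : ρ (-1) = 1 := by
    have := hu3 (-1) (by simp)
    rw [← map_pow] at this
    rw [← this]; congr 1; ring
  have e1 := aux_sumM hF3 (A * ρ⁻¹)
  have e2 : ∀ b : F, (A * ρ⁻¹) b * 
      ((Finset.univ.filter (fun y : F => y ^ 3 - 3 * b * y + b = 0)).card : ℂ) =
      (A * ρ⁻¹) b + A b * ∑ x ∈ Finset.univ.filter (fun x : F => x * (1 - x) = b), ρ x := by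
    intro b
    by_cases hb : b = 0
    · subst hb; rw [MulChar.map_zero, MulChar.map_zero]; simp
    rw [aux_M ρ h3 h1 hcube ζ hζ hF2 hF3 b hb, mul_add, mul_one, ← mul_assoc,
      ← MulChar.mul_apply, inv_mul_cancel_right]
  simp_rw [e2] at e1
  rw [Finset.sum_add_distrib, aux_sumJ, MulChar.sum_eq_zero_of_ne_one, zero_add,
    jacobiSum_comm] at e1
  · rw [e1, jacobiSum, Finset.mul_sum, Finset.mul_sum]
    refine Fintype.sum_bijective _ (mulLeft_bijective₀ 3 hF3) _ _ fun y => ?_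
    by_cases hy : y = 0
    · subst hy; simp [MulChar.map_zero]
    by_cases hy1 : 3 * y - 1 = 0
    · have : 1 - 3 * y = 0 := by linear_combination -hy1
      rw [hy1, this, div_zero, MulChar.map_zero, MulChar.map_zero]; simp
    have hi : ∀ c : F, c ≠ 0 → A⁻¹ c = (A c)⁻¹ ∧ ρ⁻¹ c = (ρ c)⁻¹ ∧ A c ≠ 0 ∧ ρ c ≠ 0 := by
      intro c hc
      refine ⟨?_, ?_, ?_, ?_⟩
      · rw [MulChar.inv_apply_eq_inv']
      · rw [MulChar.inv_apply_eq_inv']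
      · exact (hc.isUnit.map A).ne_zero
      · exact (hc.isUnit.map ρ).ne_zero
    rw [show 1 - 3 * y = (-1) * (3 * y - 1) by ring, MulChar.pow_apply' _ three_ne_zero,
      div_eq_mul_inv, show (27 : F) = 3 * 3 * 3 by norm_num]
    have hinv : ∀ χ : MulChar F ℂ, ∀ c, χ c⁻¹ = (χ c)⁻¹ := fun χ c => by
      rw [← MulChar.inv_apply', MulChar.inv_apply_eq_inv']
    simp only [map_mul, MulChar.mul_apply, map_pow, MulChar.inv_apply_eq_inv', hinv, hneg]
    have hA1 : A (-1) ≠ 0 := (hi (-1) (by simp)).2.2.1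
    have hr := hu3 y hy
    have := (hi _ hy1).2.2
    have := (hi _ hy).2.2.2
    generalize 3 * y - 1 = z at *
    field_simp
    rw [hr]
    try ring
  · intro h
    exact hA (mul_inv_eq_one.1 h)

lemma aux_refl {F : Type} [Field F] [Fintype F] (ψ : AddChar F ℂ) (hψ : ψ.IsPrimitive)
    (χ : MulChar F ℂ) (hχ : χ ≠ 1) :
    gaussSum χ ψ * gaussSum χ⁻¹ ψ = χ (-1) * (Fintype.card F : ℂ) := by
  have h1 := gaussSum_mul_gaussSum_eq_card hχ hψ
  have h2 := mul_gaussSum_inv_eq_gaussSum χ⁻¹ ψ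
  have h3 : χ⁻¹ (-1) = χ (-1) := by
    rw [MulChar.inv_apply']; congr 1; norm_num
  rw [h3] at h2
  rw [← h2, ← h1]; ring

lemma aux_g_ne {F : Type} [Field F] [Fintype F] (ψ : AddChar F ℂ) (hψ : ψ.IsPrimitive)
    (χ : MulChar F ℂ) : gaussSum χ ψ ≠ 0 := by
  by_cases h : χ = 1
  · rw [h, gaussSum_one_left (by
      have := hψ (one_ne_zero)
      rwa [AddChar.mulShift_one] at this)]
    norm_num
  · refine gaussSum_ne_zero_of_nontrivial ?_ h hψ
    simp

lemma aux_HD3 {F : Type} [Field F] [Fintype F] (ψ : AddChar F ℂ) (hψ : ψ.IsPrimitive)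
    (ρ : MulChar F ℂ) (h3 : ρ ^ 3 = 1) (h1 : ρ ≠ 1)
    (hcube : ∀ c : F, c ≠ 0 → ρ c = 1 → ∃ d, d ^ 3 = c) (ζ : F) (hζ : ζ ^ 2 + ζ + 1 = 0)
    (hF2 : (2 : F) ≠ 0) (hF3 : (3 : F) ≠ 0) (A : MulChar F ℂ) :
    gaussSum A ψ * gaussSum (A * ρ) ψ * gaussSum (A * ρ ^ 2) ψ * A 27 =
      (Fintype.card F : ℂ) * gaussSum (A ^ 3) ψ := by
  have hu3 : ∀ c : F, c ≠ 0 → ρ c ^ 3 = 1 := by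
    intro c hc
    obtain ⟨u, rfl⟩ : IsUnit c := hc.isUnit
    rw [← MulChar.pow_apply_coe, h3, MulChar.one_apply_coe]
  have hneg : ρ (-1) = 1 := by
    have := hu3 (-1) (by simp)
    rw [← map_pow] at this
    rw [← this]; congr 1; ring
  have h27 : ρ 27 = 1 := by
    rw [show (27 : F) = 3 ^ 3 by norm_num, map_pow, hu3 3 hF3]
  have key : ∀ A : MulChar F ℂ, A * (A * ρ) ≠ 1 → 
      gaussSum A ψ * gaussSum (A * ρ) ψ * gaussSum (A * ρ ^ 2) ψ * A 27 =
      (Fintype.card F : ℂ) * gaussSum (A ^ 3) ψ := by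
    intro A hA
    have hAρ : A ≠ ρ := by
      rintro rfl
      apply hA
      rw [← h3, pow_succ', pow_two]
    have e0 := aux_J3 ρ h3 h1 hcube ζ hζ hF2 hF3 A hAρ
    have e1 := jacobiSum_mul_nontrivial hA ψ
    have hp : A ^ 3 * (A⁻¹ * ρ) = A * (A * ρ) := by
      rw [pow_succ, pow_two, ← mul_assoc, mul_inv_cancel_right, mul_assoc]
    have e2 := jacobiSum_mul_nontrivial (hp ▸ hA) ψ
    rw [hp] at e2
    have e3 := aux_refl ψ hψ (A⁻¹ * ρ) (fun h => hAρ (inv_mul_eq_one.1 h))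
    have hi : (A⁻¹ * ρ)⁻¹ = A * ρ ^ 2 := by
      rw [inv_eq_iff_mul_eq_one, mul_mul_mul_comm, inv_mul_cancel, one_mul, ← pow_succ', h3]
    rw [hi, MulChar.mul_apply, hneg, mul_one, MulChar.inv_apply'] at e3
    have hn : ((-1 : F))⁻¹ = -1 := by norm_num
    rw [hn] at e3
    have hA2 : A (-1) * A (-1) = 1 := by rw [← map_mul]; simp
    apply mul_left_cancel₀ (aux_g_ne ψ hψ (A * (A * ρ)))
    generalize gaussSum (A * (A * ρ)) ψ = G at *
    generalize gaussSum (A ^ 3) ψ = G3 at *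
    generalize gaussSum (A⁻¹ * ρ) ψ = G4 at *
    generalize gaussSum (A * ρ ^ 2) ψ = G5 at *
    linear_combination (-G * G5 * A 27) * e1 + G * G5 * G * e0 + G * G5 * A (-1) * e2 +
      G * G3 * A (-1) * e3 + G * G3 * (Fintype.card F : ℂ) * hA2
  by_cases hA : A * (A * ρ) = 1
  · have e := key (A * ρ) (by
      intro h
      apply h1
      have : A * (A * ρ) = A * ρ * (A * ρ * ρ) := hA.trans h.symm
      have h4 : A * ρ * (A * ρ * ρ) = A * (A * ρ) * ρ ^ 2 := by
        rw [pow_two]; simp only [mul_assoc, mul_comm, mul_left_comm]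
      rw [h4] at this
      have h5 : ρ ^ 2 = 1 := by rwa [left_eq_mul] at this
      rw [← h3, pow_succ, h5, one_mul])
    have e1 : A * ρ * ρ = A * ρ ^ 2 := by rw [pow_two, mul_assoc]
    have e2 : A * ρ * ρ ^ 2 = A := by rw [mul_assoc, ← pow_succ', h3, mul_one]
    have e3 : (A * ρ) ^ 3 = A ^ 3 := by rw [mul_pow, h3, mul_one]
    rw [e1, e2, e3, MulChar.mul_apply, h27, mul_one] at e
    rw [← e]; ring
  · exact key A hA

lemma aux_HD2 {F : Type} [Field F] [Fintype F] (ψ : AddChar F ℂ) (hψ : ψ.IsPrimitive)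
    (η : MulChar F ℂ) (h2 : η ^ 2 = 1) (h1 : η ≠ 1)
    (hη : ∀ A : MulChar F ℂ, A * A = 1 → A ≠ 1 → A = η)
    (hsq : ∀ c : F, c ≠ 0 → η c = 1 → ∃ d, d ^ 2 = c) 
    (hF2 : (2 : F) ≠ 0) (A : MulChar F ℂ) :
    gaussSum A ψ * gaussSum (A * η) ψ * A 4 = gaussSum (A ^ 2) ψ * gaussSum η ψ := by
  have hu2 : ∀ c : F, c ≠ 0 → η c ^ 2 = 1 := by
    intro c hc
    obtain ⟨u, rfl⟩ : IsUnit c := hc.isUnit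
    rw [← MulChar.pow_apply_coe, h2, MulChar.one_apply_coe]
  have h4 : η 4 = 1 := by
    rw [show (4 : F) = 2 ^ 2 by norm_num, map_pow, hu2 2 hF2]
  have hF4 : (4 : F) ≠ 0 := by
    rw [show (4 : F) = 2 ^ 2 by norm_num]; exact pow_ne_zero _ hF2
  by_cases hA1 : A = 1
  · subst hA1
    rw [MulChar.one_apply hF4.isUnit]; simp
  by_cases hA2 : A * A = 1
  · have := hη A hA2 hA1
    subst this
    rw [h4, ← pow_two]; ring
  -- counting
  have hcount : ∀ a : F, ((Finset.univ.filter (fun x : F => x * (1 - x) = a)).card : ℂ) =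
      1 + η (1 - 4 * a) := by
    intro a
    by_cases h0 : 1 - 4 * a = 0
    · rw [h0, MulChar.map_zero]
      have : Finset.univ.filter (fun x : F => x * (1 - x) = a) = {1 / 2} := by
        ext x
        simp only [Finset.mem_filter, Finset.mem_univ, true_and, Finset.mem_singleton]
        rw [eq_div_iff hF2]
        constructor
        · intro h
          have : (x * 2 - 1) ^ 2 = 0 := by linear_combination -4 * h + h0
          exact sub_eq_zero.1 (pow_eq_zero_iff two_ne_zero |>.1 this)
        · intro h
          apply mul_left_cancel₀ hF4
          linear_combination (1 - 2 * x) * h + h0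
      rw [this]; simp
    by_cases hs : ∃ d, d ^ 2 = 1 - 4 * a
    · obtain ⟨d, hd⟩ := hs
      have hd0 : d ≠ 0 := by rintro rfl; apply h0; rw [← hd]; simp
      rw [← hd, map_pow, hu2 d hd0]
      have : Finset.univ.filter (fun x : F => x * (1 - x) = a) = {(1 + d) / 2, (1 - d) / 2} := by
        ext x
        simp only [Finset.mem_filter, Finset.mem_univ, true_and, Finset.mem_singleton,
          Finset.mem_insert]
        rw [eq_div_iff hF2, eq_div_iff hF2]
        constructor
        · intro h
          have : (x * 2 - (1 + d)) * (x * 2 - (1 - d)) = 0 := by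
            linear_combination -4 * h - hd
          rcases mul_eq_zero.1 this with h | h
          · left; linear_combination h
          · right; linear_combination h
        · intro h
          have : (x * 2 - (1 + d)) * (x * 2 - (1 - d)) = 0 := by
            rcases h with h | h
            · rw [h]; ring
            · rw [h]; ring
          apply mul_left_cancel₀ hF4
          linear_combination -this - hd
      rw [this, Finset.card_pair]
      · norm_num
      · intro h
        rw [div_left_inj' hF2] at h
        apply mul_ne_zero hF2 hd0
        linear_combination h
    · have hm : η (1 - 4 * a) = -1 := by
        have h5 := hu2 _ h0
        rw [pow_two] at h5
        rcases mul_self_eq_one_iff.1 h5 with h | h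
        · exact absurd (hsq _ h0 h) hs
        · exact h
      rw [hm]
      have : Finset.univ.filter (fun x : F => x * (1 - x) = a) = ∅ := by
        ext x
        simp only [Finset.mem_filter, Finset.mem_univ, true_and, Finset.notMem_empty, iff_false]
        intro h
        exact hs ⟨2 * x - 1, by linear_combination -4 * h⟩
      rw [this]; simp
  have hJ : A 4 * jacobiSum A A = jacobiSum A η := by
    have e := aux_sumJ A 1
    have e2 : ∀ b : F, A b * ∑ x ∈ Finset.univ.filter (fun x : F => x * (1 - x) = b), 
        (1 : MulChar F ℂ) x = A b + A b * η (1 - 4 * b) := by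
      intro b
      by_cases hb : b = 0
      · subst hb; rw [MulChar.map_zero]; simp
      have : ∑ x ∈ Finset.univ.filter (fun x : F => x * (1 - x) = b), (1 : MulChar F ℂ) x =
          ∑ x ∈ Finset.univ.filter (fun x : F => x * (1 - x) = b), 1 := by
        refine Finset.sum_congr rfl fun x hx => ?_
        simp only [Finset.mem_filter, Finset.mem_univ, true_and] at hx
        apply MulChar.one_apply
        apply Ne.isUnit
        rintro rfl
        apply hb; rw [← hx]; simp
      rw [this, Finset.sum_const, nsmul_eq_mul, mul_one, hcount]; ring
    simp_rw [e2] at e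
    rw [Finset.sum_add_distrib, MulChar.sum_eq_zero_of_ne_one hA1, zero_add, mul_one] at e
    rw [← e, jacobiSum, Finset.mul_sum]
    refine Fintype.sum_bijective _ (mulLeft_bijective₀ 4 hF4) _ _ fun y => ?_
    rw [map_mul]; ring
  have hAη : A * η ≠ 1 := by
    intro h
    apply hA2
    have : A = η⁻¹ := eq_inv_of_mul_eq_one_left h
    rw [← pow_two, this, inv_pow, h2, inv_one]
  have e1 := jacobiSum_mul_nontrivial hA2 ψ
  have e2 := jacobiSum_mul_nontrivial hAη ψ
  apply mul_left_cancel₀ (aux_g_ne ψ hψ A)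
  rw [pow_two]
  linear_combination (-gaussSum (A * η) ψ * A 4) * e1 +
    gaussSum (A * A) ψ * gaussSum (A * η) ψ * hJ + gaussSum (A * A) ψ * e2

lemma aux_psi (p : ℕ) [Fact p.Prime] (F : Type) [Field F] [Fintype F] [Algebra (ZMod p) F] :
    ∃ ψ : AddChar F ℂ, ψ.IsPrimitive ∧ ∀ χ : MulChar F ℂ, gaussChar p F χ = gaussSum χ ψ := by
  have : NeZero p := ⟨(Fact.out : p.Prime).ne_zero⟩
  refine ⟨(ZMod.stdAddChar (N := p)).compAddMonoidHom
    (Algebra.trace (ZMod p) F).toAddMonoidHom, ?_, ?_⟩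
  · apply AddChar.IsPrimitive.of_ne_one
    intro h
    have htr := (traceForm_nondegenerate (ZMod p) F).1 1
    apply one_ne_zero (α := F)
    apply htr
    intro b
    rw [Algebra.traceForm_apply, one_mul]
    have h2 := DFunLike.congr_fun h b
    apply ZMod.injective_stdAddChar (N := p)
    rw [AddChar.map_zero_eq_one]
    exact h2
  · intro χ
    unfold gaussChar gaussSum
    refine Finset.sum_congr rfl fun x _ => ?_
    congr 1
    change _ = ZMod.stdAddChar (N := p) (Algebra.trace (ZMod p) F x)
    have := ZMod.stdAddChar_coe (N := p) (((Algebra.trace (ZMod p) F x).val : ℕ) : ℤ)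
    rw [Int.cast_natCast, ZMod.natCast_zmod_val] at this
    rw [this]; simp

lemma aux_orth {F : Type} [Field F] [Fintype F] (ω : MulChar F ℂ)
    (hω : ∀ χ : MulChar F ℂ, ∃ j : ℕ, χ = ω ^ j) (z : F) :
    ∑ j ∈ Finset.range (Fintype.card F - 1), (ω ^ j) z = 
      if z = 1 then (Fintype.card F : ℂ) - 1 else 0 := by
  have hc := Fintype.one_lt_card (α := F)
  by_cases h0 : z = 0
  · subst h0
    rw [if_neg zero_ne_one]
    exact Finset.sum_eq_zero fun j _ => MulChar.map_zero _
  obtain ⟨u, rfl⟩ : IsUnit z := Ne.isUnit h0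
  simp_rw [MulChar.pow_apply_coe]
  split_ifs with h
  · rw [h, map_one]
    simp [Nat.cast_sub hc.le]
  · have h1 : ω u ≠ 1 := fun h' => h (aux_ringhelp ω hω h')
    rw [geom_sum_eq h1, ← MulChar.pow_apply_coe, aux_pow_card, MulChar.one_apply_coe]
    simp

lemma aux_delta {F : Type} [Field F] [Fintype F] (ω : MulChar F ℂ)
    (hω : ∀ χ : MulChar F ℂ, ∃ j : ℕ, χ = ω ^ j) (n : ℕ) (hn : n < Fintype.card F - 1)
    (G : MulChar F ℂ → ℂ) :
    ∑ j ∈ Finset.range (Fintype.card F - 1), (if ω ^ j = ω ^ n then G (ω ^ j) else 0) =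
      G (ω ^ n) := by
  rw [Finset.sum_eq_single_of_mem n (Finset.mem_range.2 hn), if_pos rfl]
  intro j hj hjn
  rw [if_neg]
  intro h
  rw [Finset.mem_range] at hj
  have hle : ∀ a b : ℕ, a < Fintype.card F - 1 → b < Fintype.card F - 1 → a ≤ b → 
      ω ^ a = ω ^ b → a = b := by
    intro a b ha hb hab h
    obtain ⟨c, rfl⟩ := Nat.exists_eq_add_of_le hab
    rw [pow_add, left_eq_mul] at h
    have := Nat.eq_zero_of_dvd_of_lt (aux_order ω hω c h) (by omega)
    omega
  rcases le_total j n with hl | hl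
  · exact hjn (hle j n hj hn hl h)
  · exact hjn (hle n j hn hj hl h.symm).symm

lemma aux_Jform {F : Type} [Field F] [Fintype F] (A B : MulChar F ℂ) :
    jacobiSum A (A⁻¹ * B⁻¹) = ∑ v : F, A v * B (1 + v) := by
  have hinv : ∀ χ : MulChar F ℂ, ∀ c, χ c⁻¹ = (χ c)⁻¹ := fun χ c => by
    rw [← MulChar.inv_apply', MulChar.inv_apply_eq_inv']
  rw [jacobiSum, ← Finset.sum_erase (a := (1 : F)) Finset.univ 
    (by rw [sub_self, MulChar.map_zero, mul_zero]),
    ← Finset.sum_erase (a := (-1 : F)) (f := fun v => A v * B (1 + v)) Finset.univ 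
    (by rw [add_neg_cancel, MulChar.map_zero, mul_zero])]
  refine Finset.sum_nbij' (fun u => u / (1 - u)) (fun v => v / (1 + v)) ?_ ?_ ?_ ?_ ?_
  · intro u hu
    simp only [Finset.mem_erase, Finset.mem_univ, and_true] at hu ⊢
    have : 1 - u ≠ 0 := sub_ne_zero.2 (Ne.symm hu)
    intro h
    rw [div_eq_iff this] at h
    apply one_ne_zero (α := F); linear_combination h
  · intro u hu
    simp only [Finset.mem_erase, Finset.mem_univ, and_true] at hu ⊢
    have : 1 + u ≠ 0 := fun h => hu (by linear_combination h)
    intro h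
    rw [div_eq_iff this] at h
    apply one_ne_zero (α := F); linear_combination -h
  · intro u hu
    simp only [Finset.mem_erase, Finset.mem_univ, and_true] at hu ⊢
    have : 1 - u ≠ 0 := sub_ne_zero.2 (Ne.symm hu)
    have h2 : 1 + u / (1 - u) = 1 / (1 - u) := by
      rw [eq_div_iff this, add_mul, div_mul_cancel₀ _ this]; ring
    rw [h2]; field_simp
  · intro u hu
    simp only [Finset.mem_erase, Finset.mem_univ, and_true] at hu ⊢
    have : 1 + u ≠ 0 := fun h => hu (by linear_combination h)
    have h2 : 1 - u / (1 + u) = 1 / (1 + u) := by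
      rw [eq_div_iff this, sub_mul, div_mul_cancel₀ _ this]; ring
    rw [h2]; field_simp
  · intro u hu
    simp only [Finset.mem_erase, Finset.mem_univ, and_true] at hu ⊢
    have : 1 - u ≠ 0 := sub_ne_zero.2 (Ne.symm hu)
    have h2 : 1 + u / (1 - u) = (1 - u)⁻¹ := by
      rw [← one_div, eq_div_iff this, add_mul, div_mul_cancel₀ _ this]; ring
    rw [h2, MulChar.mul_apply, MulChar.inv_apply', MulChar.inv_apply', div_eq_mul_inv, map_mul]
    ring

lemma aux_JJ {F : Type} [Field F] [Fintype F] (ω : MulChar F ℂ)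
    (hω : ∀ χ : MulChar F ℂ, ∃ j : ℕ, χ = ω ^ j) (B C : MulChar F ℂ) (x : F) (hx : x ≠ 0) :
    ∑ j ∈ Finset.range (Fintype.card F - 1), 
      jacobiSum (ω ^ j) ((ω ^ j)⁻¹ * B⁻¹) * jacobiSum (ω ^ j) ((ω ^ j)⁻¹ * C⁻¹) * (ω ^ j) x⁻¹ =
    ((Fintype.card F : ℂ) - 1) * (B (-1) * ∑ y : F, B⁻¹ y * B (1 - y) * C (1 - x * y)) := by
  have step : ∀ j : ℕ, jacobiSum (ω ^ j) ((ω ^ j)⁻¹ * B⁻¹) * 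
      jacobiSum (ω ^ j) ((ω ^ j)⁻¹ * C⁻¹) * (ω ^ j) x⁻¹ =
      ∑ v : F, ∑ w : F, B (1 + v) * C (1 + w) * (ω ^ j) (v * w * x⁻¹) := by
    intro j
    rw [aux_Jform, aux_Jform, Finset.sum_mul_sum, Finset.sum_mul]
    refine Finset.sum_congr rfl fun v _ => ?_
    rw [Finset.sum_mul]
    refine Finset.sum_congr rfl fun w _ => ?_
    rw [map_mul, map_mul]; ring
  simp_rw [step]
  rw [Finset.sum_comm, Finset.mul_sum, Finset.mul_sum]
  have hin : ∀ v : F, ∑ j ∈ Finset.range (Fintype.card F - 1), ∑ w : F, 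
      B (1 + v) * C (1 + w) * (ω ^ j) (v * w * x⁻¹) = 
      ((Fintype.card F : ℂ) - 1) * if v = 0 then 0 else B (1 + v) * C (1 + x * v⁻¹) := by
    intro v
    rw [Finset.sum_comm]
    simp_rw [← Finset.mul_sum, aux_orth ω hω]
    split_ifs with hv
    · subst hv; simp
    · rw [Finset.sum_eq_single (x * v⁻¹)]
      · rw [if_pos (by field_simp)]; ring
      · intro w _ hw
        rw [if_neg, mul_zero]
        intro h
        apply hw
        field_simp at h ⊢
        linear_combination h
      · simp
  simp_rw [hin]
  refine Finset.sum_nbij' (fun v => -v⁻¹) (fun v => -v⁻¹) (by simp) (by simp) (by simp) (by simp) ?_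
  intro v _
  by_cases hv : v = 0
  · subst hv
    simp only [if_true, inv_zero, neg_zero]
    rw [MulChar.map_zero]; ring
  · rw [if_neg hv, MulChar.inv_apply', show (-v⁻¹)⁻¹ = (-1) * v by field_simp,
      show 1 - -v⁻¹ = v⁻¹ * (1 + v) by field_simp; ring,
      show 1 - x * -v⁻¹ = 1 + x * v⁻¹ by ring, map_mul, map_mul]
    have e1 : B (-1) * B (-1) = 1 := by rw [← map_mul]; simp
    have e2 : B v * B v⁻¹ = 1 := by rw [← map_mul, mul_inv_cancel₀ hv, map_one]
    linear_combination (-((Fintype.card F : ℂ) - 1) * B (1 + v) * C (1 + x * v⁻¹)) * 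
      (e1 * (B v * B v⁻¹) + e2)

lemma aux_jacobiS {F : Type} [Field F] [Fintype F] (ψ : AddChar F ℂ) (hψ : ψ.IsPrimitive)
    (a b c : MulChar F ℂ) (habc : a * b * c = 1) (hc : c ≠ 1) :
    jacobiS F ![a, b, c] * (Fintype.card F : ℂ) = 
      - (gaussSum a ψ * gaussSum b ψ * gaussSum c ψ) := by
  have hab : a * b = c⁻¹ := eq_inv_of_mul_eq_one_left habc
  have hab1 : a * b ≠ 1 := by rw [hab]; simpa using hc
  have e1 : jacobiS F ![a, b, c] = ∑ z : F, ∑ x : F, a x * b (1 - z - x) * c z := by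
    rw [← Fintype.sum_prod_type', jacobiS]
    refine Finset.sum_nbij' (fun v => (v 2, v 0)) (fun zx => ![zx.2, 1 - zx.1 - zx.2, zx.1])
      ?_ ?_ ?_ ?_ ?_
    · simp
    · rintro ⟨z, x⟩ _
      simp [Fin.sum_univ_three]
    · intro v hv
      simp only [Finset.mem_filter, Finset.mem_univ, true_and, Fin.sum_univ_three] at hv
      ext i
      fin_cases i
      · simp
      · simp; linear_combination -hv
      · simp
    · rintro ⟨z, x⟩ _
      simp
    · intro v hv
      simp only [Finset.mem_filter, Finset.mem_univ, true_and, Fin.sum_univ_three] at hv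
      have : v 1 = 1 - v 2 - v 0 := by linear_combination hv
      simp [Fin.prod_univ_three, ← this]
  have e2 : ∀ z : F, ∑ x : F, a x * b (1 - z - x) * c z = 
      jacobiSum a b * (c z * c⁻¹ (1 - z)) := by
    intro z
    by_cases hz : 1 - z = 0
    · rw [hz, MulChar.map_zero]
      have : ∀ x : F, a x * b (0 - x) * c z = b (-1) * c z * (a * b) x := by
        intro x
        rw [zero_sub, neg_eq_neg_one_mul, map_mul, MulChar.mul_apply]; ring
      simp_rw [this]
      rw [← Finset.mul_sum, MulChar.sum_eq_zero_of_ne_one hab1]; simp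
    · rw [← hab, jacobiSum, Finset.sum_mul]
      symm
      refine Fintype.sum_bijective _ (mulLeft_bijective₀ (1 - z) hz) _ _ fun x => ?_
      rw [show 1 - z - (1 - z) * x = (1 - z) * (1 - x) by ring, map_mul, map_mul, MulChar.mul_apply]
      ring
  have e3 : jacobiS F ![a, b, c] = - (c (-1) * jacobiSum a b) := by
    rw [e1]; simp_rw [e2]
    rw [← Finset.mul_sum]
    have := jacobiSum_nontrivial_inv hc
    rw [jacobiSum] at this
    rw [this]; ring
  have e4 := jacobiSum_mul_nontrivial hab1 ψ
  have e5 := aux_refl ψ hψ c hc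
  rw [← hab] at e5
  have hc2 : c (-1) * c (-1) = 1 := by rw [← map_mul]; simp
  rw [e3]
  linear_combination (-gaussSum c ψ) * e4 + jacobiSum a b * e5

lemma aux_HD6 {F : Type} [Field F] [Fintype F] (ψ : AddChar F ℂ) (hψ : ψ.IsPrimitive)
    (ω : MulChar F ℂ) (hω : ∀ χ : MulChar F ℂ, ∃ j : ℕ, χ = ω ^ j) (t : ℕ)
    (ht : 6 * t + 1 = Fintype.card F) (σ : MulChar F ℂ) (hσ : σ = ω ^ t) (A : MulChar F ℂ) :
    gaussSum A ψ * gaussSum (A * σ) ψ * gaussSum (A * σ ^ 2) ψ * gaussSum (A * σ ^ 3) ψ *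
      gaussSum (A * σ ^ 4) ψ * gaussSum (A * σ ^ 5) ψ * A 6 ^ 6 =
    gaussSum σ ψ * gaussSum (σ ^ 2) ψ * gaussSum (σ ^ 3) ψ *
      gaussSum (σ ^ 4) ψ * gaussSum (σ ^ 5) ψ * gaussSum (A ^ 6) ψ := by
  have hc := Fintype.one_lt_card (α := F)
  have ht' : 6 * t = Fintype.card F - 1 := by omega
  have htpos : 0 < t := by omega
  have hσ6 : σ ^ 6 = 1 := by
    rw [hσ, ← pow_mul, mul_comm, ht', aux_pow_card]
  have hσn : ∀ k, 0 < k → k < 6 → σ ^ k ≠ 1 := by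
    intro k hk hk6 h
    rw [hσ, ← pow_mul] at h
    have := aux_order ω hω _ h
    rw [← ht', mul_comm] at this
    have := Nat.le_of_dvd hk (Nat.dvd_of_mul_dvd_mul_left htpos this)
    omega
  have hq0 : (6 * (t : F) + 1) = 0 := by
    have := Nat.cast_card_eq_zero F
    rw [← ht] at this
    push_cast at this
    exact this
  have hF2 : (2 : F) ≠ 0 := by
    intro h
    apply one_ne_zero (α := F)
    linear_combination hq0 - 3 * (t : F) * h
  have hF3 : (3 : F) ≠ 0 := by
    intro h
    apply one_ne_zero (α := F)
    linear_combination hq0 - 2 * (t : F) * h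
  obtain ⟨ζ, hζ⟩ : ∃ ζ : F, ζ ^ 2 + ζ + 1 = 0 := by
    obtain ⟨g, hg0, hg1, hg⟩ := aux_gen F
    refine ⟨g ^ (2 * t), ?_⟩
    have h1 : g ^ (2 * t) - 1 ≠ 0 := by
      intro h
      have := Nat.le_of_dvd (by omega) (hg _ (sub_eq_zero.1 h))
      omega
    have h2 : (g ^ (2 * t)) ^ 3 = 1 := by
      rw [← pow_mul, show 2 * t * 3 = Fintype.card F - 1 by omega]
      exact FiniteField.pow_card_sub_one_eq_one _ hg0
    apply mul_left_cancel₀ h1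
    linear_combination h2
  have hcube : ∀ c : F, c ≠ 0 → (σ ^ 2) c = 1 → ∃ d, d ^ 3 = c := by
    intro c hc h
    refine aux_root ω hω 3 (t * 2) (by omega) hc ?_
    rwa [pow_mul, ← hσ]
  have hsq : ∀ c : F, c ≠ 0 → (σ ^ 3) c = 1 → ∃ d, d ^ 2 = c := by
    intro c hc h
    refine aux_root ω hω 2 (t * 3) (by omega) hc ?_
    rwa [pow_mul, ← hσ]
  have hη : ∀ A : MulChar F ℂ, A * A = 1 → A ≠ 1 → A = σ ^ 3 := by
    intro A h1 h2
    obtain ⟨j, rfl⟩ := hω A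
    rw [← pow_add] at h1
    obtain ⟨m, hm⟩ := aux_order ω hω _ h1
    have hj : j = t * 3 * m := by
      rw [← ht'] at hm
      have : 6 * t * m = 2 * (t * 3 * m) := by ring
      omega
    rw [hj, pow_mul, pow_mul, ← hσ] at h2 ⊢
    rcases Nat.even_or_odd' m with ⟨n, rfl | rfl⟩
    · exfalso; apply h2
      rw [← pow_mul, show 3 * (2 * n) = 6 * n by ring, pow_mul, hσ6, one_pow]
    · rw [← pow_mul, show 3 * (2 * n + 1) = 6 * n + 3 by ring, pow_add, pow_mul, hσ6, one_pow,
        one_mul]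
  have hd3 := aux_HD3 ψ hψ (σ ^ 2) (by rw [← pow_mul, hσ6]) (hσn 2 (by norm_num) (by norm_num))
    hcube ζ hζ hF2 hF3
  have hd2 := aux_HD2 ψ hψ (σ ^ 3) (by rw [← pow_mul, hσ6]) (hσn 3 (by norm_num) (by norm_num))
    hη hsq hF2
  have hF27 : (27 : F) ≠ 0 := by
    rw [show (27 : F) = 3 ^ 3 by norm_num]; exact pow_ne_zero _ hF3
  have hF6 : (6 : F) ≠ 0 := by
    rw [show (6 : F) = 2 * 3 by norm_num]; exact mul_ne_zero hF2 hF3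
  have hη27 : (σ ^ 3) 27 ≠ 0 := (hF27.isUnit.map (σ ^ 3)).ne_zero
  have key : ∀ A : MulChar F ℂ, 
    gaussSum A ψ * gaussSum (A * σ) ψ * gaussSum (A * σ ^ 2) ψ * gaussSum (A * σ ^ 3) ψ *
      gaussSum (A * σ ^ 4) ψ * gaussSum (A * σ ^ 5) ψ * A 6 ^ 6 * (σ ^ 3) 27 =
    (Fintype.card F : ℂ) ^ 2 * gaussSum (σ ^ 3) ψ * gaussSum (A ^ 6) ψ := by
    intro A
    have e1 := hd3 A
    have e2 := hd3 (A * σ ^ 3)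
    have e3 := hd2 (A ^ 3)
    have p1 : A * σ ^ 3 * σ ^ 2 = A * σ ^ 5 := by rw [mul_assoc, ← pow_add]
    have p2 : A * σ ^ 3 * (σ ^ 2) ^ 2 = A * σ := by
      rw [mul_assoc, ← pow_mul, ← pow_add, show 3 + 2 * 2 = 6 + 1 by norm_num, pow_succ, hσ6,
        one_mul]
    have p3 : (A * σ ^ 3) ^ 3 = A ^ 3 * σ ^ 3 := by
      rw [mul_pow, ← pow_mul, show 3 * 3 = 6 + 3 by norm_num, pow_add σ, hσ6, one_mul]
    rw [← pow_mul] at e1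
    rw [p1, p2, p3, MulChar.mul_apply] at e2
    rw [← pow_mul, MulChar.pow_apply' _ three_ne_zero] at e3
    norm_num at e1 e3
    have p4 : A 6 ^ 6 = A 27 * A 27 * A 4 ^ 3 := by
      rw [← map_pow, ← map_pow, ← map_mul, ← map_mul]; norm_num
    rw [p4]
    generalize (Fintype.card F : ℂ) = q at *
    generalize gaussSum (A ^ 3 * σ ^ 3) ψ = G33 at *
    generalize gaussSum (A ^ 3) ψ = G3 at *
    generalize (σ ^ 3) 27 = e27 at *
    generalize gaussSum (A * σ ^ 3) ψ = x3 at *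
    generalize gaussSum (A * σ ^ 5) ψ = x5 at *
    generalize gaussSum (A * σ ^ 4) ψ = x4 at *
    generalize gaussSum (A * σ ^ 2) ψ = x2 at *
    generalize gaussSum (A * σ) ψ = x1 at *
    linear_combination (x3 * x5 * x1 * A 27 * e27 * A 4 ^ 3) * e1 + q * G3 * A 4 ^ 3 * e2 + 
      q ^ 2 * e3
  have k1 := key 1
  have hψ1 : ψ ≠ 1 := by
    have := hψ (one_ne_zero)
    rwa [AddChar.mulShift_one] at this
  simp only [one_mul, one_pow] at k1
  rw [gaussSum_one_left hψ1, MulChar.one_apply hF6.isUnit] at k1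
  apply mul_right_cancel₀ hη27
  have kA := key A
  linear_combination kA + gaussSum (A ^ 6) ψ * k1

lemma aux_Nq (p : ℕ) [Fact p.Prime] (F : Type) [Field F] [Fintype F] [Algebra (ZMod p) F]
    (ψ : AddChar F ℂ) (hg : ∀ χ : MulChar F ℂ, gaussChar p F χ = gaussSum χ ψ)
    (ω : MulChar F ℂ) (t : ℕ) (ht : 6 * t + 1 = Fintype.card F) 
    (σ : MulChar F ℂ) (hσ : σ = ω ^ t) :
    (∑ k ∈ Finset.range 6, NqW p F ω 6 
      (fun i => (![0,0,0,3,4,5] : Fin 6 → ZMod 6) i + (k : ZMod 6))) =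
    1 / (Fintype.card F : ℂ) * (gaussSum (σ ^ 4) ψ ^ 3 * gaussSum σ ψ * gaussSum (σ ^ 2) ψ *
      gaussSum (σ ^ 3) ψ) + 1 / (Fintype.card F : ℂ) * (gaussSum (σ ^ 5) ψ ^ 3 * 
      gaussSum (σ ^ 2) ψ * gaussSum (σ ^ 3) ψ * gaussSum (σ ^ 4) ψ) := by
  have ht' : (Fintype.card F - 1) / 6 = t := by omega
  have hp : ∀ k, ω ^ (k * t) = σ ^ k := by
    intro k; rw [hσ, ← pow_mul, mul_comm]
  have z : ∀ w : Fin 6 → ZMod 6, (¬ ∀ i, w i = 0) → (¬ ∀ i, w i ≠ 0) → NqW p F ω 6 w = 0 := by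
    intro w h1 h2
    rw [NqW, if_neg h1, if_neg h2]
  have nz : ∀ w : Fin 6 → ZMod 6, (¬ ∀ i, w i = 0) → (∀ i, w i ≠ 0) → NqW p F ω 6 w = 
      1 / (Fintype.card F : ℂ) * ∏ i, gaussSum (σ ^ (w i).val) ψ := by
    intro w h1 h2
    rw [NqW, if_neg h1, if_pos h2, ht']
    simp_rw [hg, hp]
  have c4 : (fun i => (![0,0,0,3,4,5] : Fin 6 → ZMod 6) i + ((4 : ℕ) : ZMod 6)) = 
      ![4, 4, 4, 1, 2, 3] := by decide
  have c5 : (fun i => (![0,0,0,3,4,5] : Fin 6 → ZMod 6) i + ((5 : ℕ) : ZMod 6)) = 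
      ![5, 5, 5, 2, 3, 4] := by decide
  simp only [Finset.sum_range_succ, Finset.sum_range_zero]
  rw [c4, c5, z _ (by decide) (by decide), z _ (by decide) (by decide), z _ (by decide) (by decide), 
    z _ (by decide) (by decide), nz _ (by decide) (by decide), nz _ (by decide) (by decide),
    Fin.prod_univ_six, Fin.prod_univ_six]
  have v1 : (1 : ZMod 6).val = 1 := rfl
  have v2 : (2 : ZMod 6).val = 2 := rfl
  have v3 : (3 : ZMod 6).val = 3 := rfl
  have v4 : (4 : ZMod 6).val = 4 := rfl
  have v5 : (5 : ZMod 6).val = 5 := rfl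
  simp [v1, v2, v3, v4, v5]
  ring

lemma aux_SW (p : ℕ) [Fact p.Prime] (F : Type) [Field F] [Fintype F] [Algebra (ZMod p) F]
    (ψ : AddChar F ℂ) (hg : ∀ χ : MulChar F ℂ, gaussChar p F χ = gaussSum χ ψ)
    (ω : MulChar F ℂ) (t : ℕ) (ht : 6 * t + 1 = Fintype.card F) 
    (σ : MulChar F ℂ) (hσ : σ = ω ^ t) (lam : F) :
    SW p F ω 6 (fun _ => 1) (![0,0,0,3,4,5] : Fin 6 → ZMod 6) lam = 
      ((Fintype.card F : ℂ) - 1)⁻¹ * ∑ j ∈ Finset.range (Fintype.card F - 1),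
        (gaussSum (ω ^ j) ψ ^ 3 * gaussSum (ω ^ j * σ ^ 3) ψ * gaussSum (ω ^ j * σ ^ 4) ψ *
        gaussSum (ω ^ j * σ ^ 5) ψ) / gaussSum ((ω ^ j) ^ 6) ψ * ((ω ^ j) 6 ^ 6 * (ω ^ j) (lam ^ 6)) := by
  have ht' : (Fintype.card F - 1) / 6 = t := by omega
  have hp : ∀ k j, ω ^ (k * t + 1 * j) = ω ^ j * σ ^ k := by
    intro k j; rw [hσ, ← pow_mul, ← pow_add]; congr 1; ring
  rw [SW, ht']
  congr 1
  refine Finset.sum_congr rfl fun j _ => ?_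
  rw [Fin.prod_univ_six]
  simp_rw [hg, hp]
  have v3 : (3 : ZMod 6).val = 3 := rfl
  have v4 : (4 : ZMod 6).val = 4 := rfl
  have v5 : (5 : ZMod 6).val = 5 := rfl
  have hl : (ω ^ (6 * j)) (((6 : ℕ) : F) * lam) = (ω ^ j) 6 ^ 6 * (ω ^ j) (lam ^ 6) := by
    rw [mul_comm, pow_mul, MulChar.pow_apply' _ (by norm_num), map_mul, mul_pow, map_pow]
    norm_num
  rw [hl, mul_comm 6 j, pow_mul]
  congr 2
  simp [v3, v4, v5]
  exact Or.inl (Or.inl (Or.inl (by ring)))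

lemma aux_inv {F : Type} [Field F] [Fintype F] (ψ : AddChar F ℂ) (hψ : ψ.IsPrimitive)
    (χ : MulChar F ℂ) : (gaussSum χ ψ)⁻¹ = χ (-1) * gaussSum χ⁻¹ ψ / (Fintype.card F : ℂ) +
      if χ = 1 then -((Fintype.card F : ℂ) - 1) / (Fintype.card F : ℂ) else 0 := by
  have hQ : (Fintype.card F : ℂ) ≠ 0 := by
    exact_mod_cast Fintype.card_ne_zero
  have hψ1 : ψ ≠ 1 := by
    have := hψ (one_ne_zero)
    rwa [AddChar.mulShift_one] at this
  split_ifs with h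
  · subst h
    rw [inv_one, gaussSum_one_left hψ1, MulChar.one_apply (by simp)]
    field_simp
    ring
  · have e := aux_refl ψ hψ χ h
    have hg := aux_g_ne ψ hψ χ
    have hc2 : χ (-1) * χ (-1) = 1 := by rw [← map_mul]; simp
    rw [add_zero, eq_div_iff hQ, inv_mul_eq_iff_eq_mul₀ hg]
    linear_combination (-χ (-1)) * e - (Fintype.card F : ℂ) * hc2

/-- The contribution of the class of `w = (0,0,0,3,4,5)` in Koblitz's formula. -/
theorem class_000345 (p e q t : ℕ) [Fact p.Prime] (F : Type) [Field F] [Fintype F]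
    [Algebra (ZMod p) F]
    (he : 0 < e) (hq : q = Fintype.card F) (hqe : q = p ^ e) (hmod : q % 6 = 1)
    (ht : t = (q - 1) / 6)
    (ω : MulChar F ℂ) (hω : ∀ χ : MulChar F ℂ, ∃ j : ℕ, χ = ω ^ j)
    (ω₆ ω₃ ω₂ : MulChar F ℂ)
    (hω₆ : ω₆ = ω ^ t) (hω₃ : ω₃ = ω ^ (2 * t)) (hω₂ : ω₂ = ω ^ (3 * t))
    (lam : F) (hlam : lam ≠ 0) (hlam6 : lam ^ 6 ≠ 1) :
    (∑ k ∈ Finset.range 6, NqW p F ω 6 (fun i => (![0,0,0,3,4,5] : Fin 6 → ZMod 6) i + (k : ZMod 6))) +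
      SW p F ω 6 (fun _ => 1) (![0,0,0,3,4,5] : Fin 6 → ZMod 6) lam =
      -((q : ℂ) ^ 2) * jacobiS F ![ω₂, ω₃⁻¹, ω₆⁻¹] * greene2F1 F ω₃⁻¹ ω₆⁻¹ 1 (lam ^ 6)⁻¹ := by
  subst hq
  have hc := Fintype.one_lt_card (α := F)
  have ht1 : 6 * t + 1 = Fintype.card F := by omega
  have htpos : 0 < t := by omega
  obtain ⟨ψ, hψ, hg⟩ := aux_psi p F
  have h3 : ω₃ = ω₆ ^ 2 := by rw [hω₃, hω₆, ← pow_mul, mul_comm]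
  have h2 : ω₂ = ω₆ ^ 3 := by rw [hω₂, hω₆, ← pow_mul, mul_comm]
  rw [aux_Nq p F ψ hg ω t ht1 ω₆ hω₆, aux_SW p F ψ hg ω t ht1 ω₆ hω₆, h3, h2]
  have HD := aux_HD6 ψ hψ ω hω t ht1 ω₆ hω₆
  have hσ6 : ω₆ ^ 6 = 1 := by
    rw [hω₆, ← pow_mul, mul_comm, show 6 * t = Fintype.card F - 1 by omega, aux_pow_card]
  have hσn : ∀ k, 0 < k → k < 6 → ω₆ ^ k ≠ 1 := by
    intro k hk hk6 h
    rw [hω₆, ← pow_mul] at h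
    have := aux_order ω hω _ h
    rw [← ht1, Nat.add_sub_cancel, mul_comm] at this
    have := Nat.le_of_dvd hk (Nat.dvd_of_mul_dvd_mul_left htpos this)
    omega
  have h5 : ω ^ (5 * t) = ω₆ ^ 5 := by rw [hω₆, ← pow_mul, mul_comm]
  have h4 : ω ^ (4 * t) = ω₆ ^ 4 := by rw [hω₆, ← pow_mul, mul_comm]
  have hD5 := aux_delta ω hω (5 * t) (by omega)
  have hD4 := aux_delta ω hω (4 * t) (by omega)
  rw [h5] at hD5
  rw [h4] at hD4
  clear hω₆ hω₃ hω₂ h3 h2 h5 h4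
  generalize ω₆ = σ at *
  have hi1 : σ⁻¹ = σ ^ 5 := (eq_inv_of_mul_eq_one_left (by rw [← pow_succ, hσ6])).symm
  have hi2 : (σ ^ 2)⁻¹ = σ ^ 4 := (eq_inv_of_mul_eq_one_left (by rw [← pow_add, hσ6])).symm
  have hJS := aux_jacobiS ψ hψ (σ ^ 3) (σ ^ 2)⁻¹ σ⁻¹ (by
    rw [hi1, hi2, ← pow_add, ← pow_add, show 3 + 4 + 5 = 6 * 2 by norm_num, pow_mul, hσ6, one_pow])
    (by rw [hi1]; exact hσn 5 (by norm_num) (by norm_num))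
  have hx : (lam ^ 6)⁻¹ ≠ 0 := inv_ne_zero (pow_ne_zero _ hlam)
  have hJJ := aux_JJ ω hω σ (σ ^ 2) (lam ^ 6)⁻¹ hx
  rw [inv_inv] at hJJ
  have hL : ∀ k, (σ ^ k) (lam ^ 6) = 1 := by
    intro k
    obtain ⟨u, rfl⟩ : IsUnit lam := hlam.isUnit
    rw [map_pow, MulChar.pow_apply_coe, ← pow_mul, mul_comm, pow_mul, ← MulChar.pow_apply_coe,
      hσ6, MulChar.one_apply_coe, one_pow]
  have hQ : (Fintype.card F : ℂ) ≠ 0 := by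
    exact_mod_cast Fintype.card_ne_zero
  have hQ1 : (Fintype.card F : ℂ) - 1 ≠ 0 := by
    rw [sub_ne_zero]; exact_mod_cast hc.ne'
  have hG := aux_g_ne ψ hψ
  have r1 := aux_refl ψ hψ σ (by simpa using hσn 1 (by norm_num) (by norm_num))
  have r2 := aux_refl ψ hψ (σ ^ 2) (hσn 2 (by norm_num) (by norm_num))
  have hs2 : (σ ^ 2) (-1) = 1 := by
    rw [MulChar.pow_apply' _ two_ne_zero, ← map_pow]; simp
  have hs1 : σ (-1) * σ (-1) = 1 := by rw [← map_mul]; simp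
  obtain ⟨P, hP⟩ : ∃ P, P = gaussSum σ ψ * gaussSum (σ ^ 2) ψ * gaussSum (σ ^ 3) ψ *
      gaussSum (σ ^ 4) ψ * gaussSum (σ ^ 5) ψ := ⟨_, rfl⟩
  rw [← hP] at HD
  -- each summand
  have hterm : ∀ A : MulChar F ℂ, 
      (gaussSum A ψ ^ 3 * gaussSum (A * σ ^ 3) ψ * gaussSum (A * σ ^ 4) ψ *
        gaussSum (A * σ ^ 5) ψ) / gaussSum (A ^ 6) ψ * (A 6 ^ 6 * A (lam ^ 6)) =
      P / (Fintype.card F : ℂ) ^ 2 * σ (-1) * gaussSum σ⁻¹ ψ * gaussSum (σ ^ 2)⁻¹ ψ *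
        (jacobiSum A (A⁻¹ * σ⁻¹) * jacobiSum A (A⁻¹ * (σ ^ 2)⁻¹) * A (lam ^ 6)) +
      ((if A = σ ^ 5 then P * gaussSum A ψ ^ 2 * A (lam ^ 6) * 
        (-((Fintype.card F : ℂ) - 1) / (Fintype.card F : ℂ)) * (gaussSum (A * σ ^ 2) ψ)⁻¹ else 0) +
      (if A = σ ^ 4 then P * gaussSum A ψ ^ 2 * A (lam ^ 6) * 
        (-((Fintype.card F : ℂ) - 1) / (Fintype.card F : ℂ)) * (gaussSum (A * σ) ψ)⁻¹ else 0)) := by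
    intro A
    have a1 : A = σ ^ 5 ↔ A * σ = 1 := by rw [← hi1, eq_inv_iff_mul_eq_one]
    have a2 : A = σ ^ 4 ↔ A * σ ^ 2 = 1 := by rw [← hi2, eq_inv_iff_mul_eq_one]
    have i1 := aux_inv ψ hψ (A * σ)
    have i2 := aux_inv ψ hψ (A * σ ^ 2)
    have j1 := jacobiSum_mul_nontrivial (χ := A) (φ := A⁻¹ * σ⁻¹) (by
      rw [mul_inv_cancel_left, hi1]; exact hσn 5 (by norm_num) (by norm_num)) ψ
    have j2 := jacobiSum_mul_nontrivial (χ := A) (φ := A⁻¹ * (σ ^ 2)⁻¹) (by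
      rw [mul_inv_cancel_left, hi2]; exact hσn 4 (by norm_num) (by norm_num)) ψ
    rw [mul_inv_cancel_left] at j1 j2
    rw [mul_inv, MulChar.mul_apply] at i1 i2
    rw [hs2] at i2
    have hA2 : A (-1) * A (-1) = 1 := by rw [← map_mul]; simp
    have e0 : (gaussSum A ψ ^ 3 * gaussSum (A * σ ^ 3) ψ * gaussSum (A * σ ^ 4) ψ *
        gaussSum (A * σ ^ 5) ψ) / gaussSum (A ^ 6) ψ * (A 6 ^ 6 * A (lam ^ 6)) =
        P * gaussSum A ψ ^ 2 * A (lam ^ 6) * ((gaussSum (A * σ) ψ)⁻¹ *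
        (gaussSum (A * σ ^ 2) ψ)⁻¹) := by
      have n1 := hG (A * σ)
      have n2 := hG (A * σ ^ 2)
      have n6 := hG (A ^ 6)
      have hh := HD A
      generalize gaussSum (A * σ) ψ = x1 at *
      generalize gaussSum (A * σ ^ 2) ψ = x2 at *
      generalize gaussSum (A ^ 6) ψ = x6 at *
      generalize A (lam ^ 6) = l at *
      generalize A 6 ^ 6 = b at *
      field_simp
      linear_combination (gaussSum A ψ ^ 2 * l) * hh
    have e1 : P / (Fintype.card F : ℂ) ^ 2 * σ (-1) * gaussSum σ⁻¹ ψ * gaussSum (σ ^ 2)⁻¹ ψ *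
        (jacobiSum A (A⁻¹ * σ⁻¹) * jacobiSum A (A⁻¹ * (σ ^ 2)⁻¹) * A (lam ^ 6)) =
        P * gaussSum A ψ ^ 2 * A (lam ^ 6) *
        ((A (-1) * σ (-1) * gaussSum (A⁻¹ * σ⁻¹) ψ / (Fintype.card F : ℂ)) *
        (A (-1) * 1 * gaussSum (A⁻¹ * (σ ^ 2)⁻¹) ψ / (Fintype.card F : ℂ))) := by
      have : P / (Fintype.card F : ℂ) ^ 2 * σ (-1) * gaussSum σ⁻¹ ψ * gaussSum (σ ^ 2)⁻¹ ψ *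
        (jacobiSum A (A⁻¹ * σ⁻¹) * jacobiSum A (A⁻¹ * (σ ^ 2)⁻¹) * A (lam ^ 6)) = 
        P / (Fintype.card F : ℂ) ^ 2 * σ (-1) * (gaussSum σ⁻¹ ψ * jacobiSum A (A⁻¹ * σ⁻¹)) *
        (gaussSum (σ ^ 2)⁻¹ ψ * jacobiSum A (A⁻¹ * (σ ^ 2)⁻¹)) * A (lam ^ 6) * 
        (A (-1) * A (-1)) := by rw [hA2]; ring
      rw [this, j1, j2]
      ring
    rw [e0, e1]
    by_cases c1 : A = σ ^ 5
    · have c2 : ¬ A = σ ^ 4 := by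
        intro c2
        apply hσn 1 (by norm_num) (by norm_num)
        rw [c1, show 5 = 4 + 1 by norm_num, pow_add] at c2
        rwa [mul_eq_left] at c2
      rw [if_pos c1, if_neg c2]
      rw [if_pos (a1.1 c1)] at i1
      rw [if_neg (fun h => c2 (a2.2 h)), add_zero] at i2
      rw [i2, i1]; ring
    · rw [if_neg c1]
      rw [if_neg (fun h => c1 (a1.2 h)), add_zero] at i1
      by_cases c2 : A = σ ^ 4
      · rw [if_pos c2]
        rw [if_pos (a2.1 c2)] at i2
        rw [i2, i1]; ring
      · rw [if_neg c2]
        rw [if_neg (fun h => c2 (a2.2 h)), add_zero] at i2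
        rw [i2, i1]; ring
  simp_rw [hterm]
  rw [Finset.sum_add_distrib, Finset.sum_add_distrib, ← Finset.mul_sum, hJJ,
    hD5 (fun A => P * gaussSum A ψ ^ 2 * A (lam ^ 6) * 
        (-((Fintype.card F : ℂ) - 1) / (Fintype.card F : ℂ)) * (gaussSum (A * σ ^ 2) ψ)⁻¹),
    hD4 (fun A => P * gaussSum A ψ ^ 2 * A (lam ^ 6) * 
        (-((Fintype.card F : ℂ) - 1) / (Fintype.card F : ℂ)) * (gaussSum (A * σ) ψ)⁻¹),
    hL, hL, show σ ^ 5 * σ ^ 2 = σ by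
      rw [← pow_add, show 5 + 2 = 6 + 1 by norm_num, pow_succ, hσ6, one_mul],
    show σ ^ 4 * σ = σ ^ 5 from (pow_succ _ _).symm, greene2F1, MulChar.one_apply hx.isUnit]
  simp only [mul_one, inv_inv, one_mul]
  have hsi : σ⁻¹ (-1) = σ (-1) := by
    rw [MulChar.inv_apply']; congr 1; norm_num
  rw [hsi]
  rw [hs2] at r2
  generalize (∑ y : F, σ⁻¹ y * σ (1 - y) * (σ ^ 2) (1 - (lam ^ 6)⁻¹ * y)) = T at *
  rw [hi1, hi2] at *
  have n1 := hG σ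
  have n5 := hG (σ ^ 5)
  generalize jacobiS F ![σ ^ 3, σ ^ 4, σ ^ 5] = J at *
  generalize gaussSum σ ψ = g1 at *
  generalize gaussSum (σ ^ 2) ψ = g2 at *
  generalize gaussSum (σ ^ 3) ψ = g3 at *
  generalize gaussSum (σ ^ 4) ψ = g4 at *
  generalize gaussSum (σ ^ 5) ψ = g5 at *
  clear hterm HD hD5 hD4 hJJ hG hL hσn
  generalize (Fintype.card F : ℂ) = Q at *
  generalize σ (-1) = s at *
  have hJ : J = - (g3 * g4 * g5) / Q := by
    rw [eq_div_iff hQ, hJS]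
  rw [hJ, hP]
  clear hJ hJS hP
  have hfin : g1 * g2 * g3 * g4 * g5 * (s * s) * g4 * g5 = s * g3 * g4 * g5 * Q ^ 2 := by
    rw [hs1]
    linear_combination (g3 * g4 * g5 * g2 * g4) * r1 + s * Q * g3 * g4 * g5 * r2
  field_simp
  linear_combination T * hfin
end

section
/- Let q = p^e be a power of a prime with q ≡ 1 (mod 6), t = (q-1)/6, ω₆ = ω^t, ω₃ = ω^{2t}, ω₂ = ω^{3t}, and let λ ∈ 𝔽_q with λ ≠ 0 and λ⁶ ≠ 1. For the equivalence class of w = (0,0,1,3,3,5): Σ_{w'∈[0,0,1,3,3,5]} N_q(0,w') + S_{[0,0,1,3,3,5]} = −q²·J(ω₆,ω₃,ω₂)·₂F₁(ω₃,ω̄₃; ω₂ | 1/λ⁶)_q. -/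
open scoped Classical

section helpers

set_option linter.unusedSectionVars false

variable {F : Type} [Field F] [Fintype F]

lemma char_prime_pow_iff {n : ℕ} (hn : n.Prime) {χ : MulChar F ℂ} (h1 : χ ≠ 1) (hχ : χ ^ n = 1)
    {a : F} (ha : a ≠ 0) (h : χ a = 1) : ∃ b : F, b ^ n = a := by
  obtain ⟨g, hg⟩ := IsCyclic.exists_generator (α := Fˣ)
  have hgn : χ g ≠ 1 := by
    intro h2
    apply h1
    rw [MulChar.eq_iff hg, h2, MulChar.one_apply_coe]
  have hpow : (χ g) ^ n = 1 := by
    rw [← MulChar.pow_apply_coe, hχ, MulChar.one_apply_coe]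
  have hord : orderOf (χ (g : F)) = n := by
    have := Fact.mk hn
    exact orderOf_eq_prime hpow hgn
  obtain ⟨k, hk⟩ := (mem_powers_iff_mem_zpowers (x := g)).mpr (hg (Units.mk0 a ha))
  have hk' : a = (g : F) ^ k := by
    have := congrArg (Units.val) hk
    simpa using this.symm
  rw [hk', map_pow] at h
  have hd := orderOf_dvd_of_pow_eq_one h
  rw [hord] at hd
  obtain ⟨m, rfl⟩ := hd
  exact ⟨(g : F) ^ m, by rw [hk', ← pow_mul, mul_comm]⟩

lemma chi_unit_pow {n : ℕ} {χ : MulChar F ℂ} (hχ : χ ^ n = 1) {a : F} (ha : a ≠ 0) :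
    (χ a) ^ n = 1 := by
  have := MulChar.pow_apply_coe χ n (Units.mk0 a ha)
  rw [hχ, MulChar.one_apply_coe] at this
  simpa using this.symm

lemma chi_ne_zero (χ : MulChar F ℂ) {a : F} (ha : a ≠ 0) : χ a ≠ 0 := by
  rw [MulChar.apply_ne_zero_iff]; exact ha.isUnit

lemma chi_pow_app (χ : MulChar F ℂ) (n : ℕ) {a : F} (ha : a ≠ 0) : (χ ^ n) a = χ a ^ n := by
  have := MulChar.pow_apply_coe χ n (Units.mk0 a ha)
  simpa using this

/-- number of square roots -/
lemma card_sq (h2 : (2 : F) ≠ 0) {φ : MulChar F ℂ} (h1 : φ ≠ 1) (hφ : φ ^ 2 = 1) (s : F) :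
    ((Finset.univ.filter (fun z : F => z ^ 2 = s)).card : ℂ) = 1 + φ s := by
  by_cases hs : s = 0
  · subst hs
    have : Finset.univ.filter (fun z : F => z ^ 2 = 0) = {0} := by
      ext z; simp
    rw [this, MulChar.map_zero]; simp
  by_cases hb : ∃ b : F, b ^ 2 = s
  · obtain ⟨b, rfl⟩ := hb
    have hb0 : b ≠ 0 := by rintro rfl; simp at hs
    have : Finset.univ.filter (fun z : F => z ^ 2 = b ^ 2) = {b, -b} := by
      ext z; simp [sq_eq_sq_iff_eq_or_eq_neg]
    rw [this, Finset.card_pair, map_pow, chi_unit_pow hφ hb0]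
    · norm_num
    · intro h
      apply hb0
      have : 2 * b = 0 := by linear_combination h
      simpa [h2] using this
  · have h3 : φ s ≠ 1 := fun h => hb (char_prime_pow_iff Nat.prime_two h1 hφ hs h)
    have h4 := chi_unit_pow hφ hs
    have h5 : φ s = -1 := by
      rcases mul_self_eq_one_iff.mp ((sq _).symm.trans h4) with h | h
      · exact absurd h h3
      · exact h
    have : Finset.univ.filter (fun z : F => z ^ 2 = s) = ∅ := by
      ext z; simp; intro h; exact hb ⟨z, h⟩
    rw [this, h5]; simp

lemma sum_fiber {f : F → F} (h : F → ℂ) :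
    ∑ z : F, h (f z) = ∑ s : F, ((Finset.univ.filter (fun z : F => f z = s)).card : ℂ) * h s := by
  rw [← Finset.sum_fiberwise (s := Finset.univ) (g := f)]
  refine Finset.sum_congr rfl fun s _ => ?_
  rw [Finset.sum_congr rfl (g := fun _ => h s)]
  · simp
  · intro x hx
    rw [(Finset.mem_filter.mp hx).2]

/-- Jacobi sum form of the quadratic Hasse-Davenport relation -/
lemma jac2 (h2 : (2 : F) ≠ 0) {φ : MulChar F ℂ} (h1 : φ ≠ 1) (hφ : φ ^ 2 = 1)
    {χ : MulChar F ℂ} (hχ : χ ≠ 1) : χ 4 * jacobiSum χ χ = jacobiSum φ χ := by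
  have e1 : χ 4 * jacobiSum χ χ = ∑ z : F, χ (1 - z ^ 2) := by
    unfold jacobiSum
    rw [Finset.mul_sum]
    have h2' : (1 : F) / 2 ≠ 0 := by simpa using h2
    refine (Fintype.sum_equiv (((Equiv.addLeft (1 : F))).trans (Equiv.mulRight₀ (1 / 2 : F) h2')) _ _ ?_).symm
    intro z
    change χ (1 - z ^ 2) = χ 4 * (χ ((1 + z) * (1 / 2)) * χ (1 - (1 + z) * (1 / 2)))
    rw [← map_mul, ← map_mul]
    congr 1
    field_simp
    ring
  rw [e1, sum_fiber (f := fun z => z ^ 2) (h := fun s => χ (1 - s))]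
  unfold jacobiSum
  rw [Finset.sum_congr rfl (fun s _ => by rw [card_sq h2 h1 hφ s, add_mul, one_mul]),
    Finset.sum_add_distrib]
  have : ∑ s : F, χ (1 - s) = 0 := by
    rw [← MulChar.sum_eq_zero_of_ne_one hχ]
    exact Fintype.sum_equiv (Equiv.subLeft (1 : F)) _ _ (fun x => rfl)
  rw [this, zero_add]

lemma gs_ne_zero {ψ : AddChar F ℂ} (hψ : ψ.IsPrimitive) (χ : MulChar F ℂ) : gaussSum χ ψ ≠ 0 := by
  by_cases h : χ = 1
  · subst h
    have : ψ ≠ 1 := by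
      have := hψ (a := 1) one_ne_zero
      simpa using this
    rw [gaussSum_one_left this]; simp
  · exact gaussSum_ne_zero_of_nontrivial (by exact_mod_cast Fintype.card_ne_zero) h hψ

lemma gs_one {ψ : AddChar F ℂ} (hψ : ψ.IsPrimitive) : gaussSum (1 : MulChar F ℂ) ψ = -1 := by
  apply gaussSum_one_left
  have := hψ (a := 1) one_ne_zero
  simpa using this

lemma gs_inv {ψ : AddChar F ℂ} (hψ : ψ.IsPrimitive) {χ : MulChar F ℂ} (hχ : χ ≠ 1) :
    gaussSum χ ψ * gaussSum χ⁻¹ ψ = χ (-1) * Fintype.card F := by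
  have h := gaussSum_mul_gaussSum_eq_card hχ hψ
  have h2 := mul_gaussSum_inv_eq_gaussSum χ⁻¹ ψ
  rw [← h2, ← h]
  have : (χ⁻¹) (-1) = χ (-1) := by rw [MulChar.inv_apply']; simp [inv_neg]
  rw [this]; ring

lemma chi_neg_one_sq (χ : MulChar F ℂ) : χ (-1) * χ (-1) = 1 := by
  rw [← map_mul]; simp

/-- Hasse-Davenport for 2 -/
lemma hd2 {ψ : AddChar F ℂ} (hψ : ψ.IsPrimitive) (h2 : (2 : F) ≠ 0) {φ : MulChar F ℂ}
    (h1 : φ ≠ 1) (hφ : φ ^ 2 = 1) (χ : MulChar F ℂ) :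
    gaussSum χ ψ * gaussSum (χ * φ) ψ * χ 4 = gaussSum (χ ^ 2) ψ * gaussSum φ ψ := by
  have h4 : (4 : F) ≠ 0 := by
    have : (4 : F) = 2 ^ 2 := by norm_num
    rw [this]; exact pow_ne_zero _ h2
  have hφφ : φ * φ = 1 := by rw [← sq, hφ]
  by_cases hχ : χ = 1
  · subst hχ
    rw [MulChar.one_apply h4.isUnit]; simp
  by_cases hχφ : χ = φ
  · subst hχφ
    have : (4 : F) = 2 ^ 2 := by norm_num
    rw [hφφ, hφ, this, map_pow, chi_unit_pow hφ h2]; ring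
  have hc2 : χ * χ ≠ 1 := by
    intro h
    apply hχφ
    ext a
    have c1 := card_sq h2 hχ (by rw [sq]; exact h) (a : F)
    have c2 := card_sq h2 h1 hφ (a : F)
    exact add_left_cancel (c1.symm.trans c2)
  have hcφ : χ * φ ≠ 1 := by
    intro h
    apply hχφ
    exact mul_right_cancel (h.trans hφφ.symm)
  have j := jac2 h2 h1 hφ hχ
  have g1 := jacobiSum_mul_nontrivial hc2 ψ
  have g2 := jacobiSum_mul_nontrivial (χ := φ) (φ := χ) (by rwa [mul_comm]) ψ
  have hg := gs_ne_zero hψ χ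
  rw [mul_comm φ χ] at g2
  rw [sq]
  apply mul_left_cancel₀ hg
  linear_combination gaussSum (χ * φ) ψ * gaussSum (χ*χ) ψ * j - gaussSum (χ * φ) ψ * χ 4 * g1 + gaussSum (χ * χ) ψ * g2

end helpers

section cubic

set_option linter.unusedSectionVars false

variable {F : Type} [Field F] [Fintype F]

lemma add_inv_eq_iff {y z : F} (hy : y ≠ 0) (hz : z ≠ 0) (h : y + y⁻¹ = z + z⁻¹) :
    y = z ∨ y = z⁻¹ := by
  have : (y - z) * (y - z⁻¹) = 0 := by
    field_simp at h ⊢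
    linear_combination h
  rcases mul_eq_zero.mp this with h | h
  · left; exact sub_eq_zero.mp h
  · right; exact sub_eq_zero.mp h

lemma exists_zeta {θ : MulChar F ℂ} (h1 : θ ≠ 1) (hθ : θ ^ 3 = 1) :
    ∃ ζ : F, ζ ^ 2 + ζ + 1 = 0 := by
  have := Fact.mk Nat.prime_three
  have ho : orderOf θ = 3 := orderOf_eq_prime hθ h1
  have hd : 3 ∣ Fintype.card F - 1 := by
    rw [← ho]; exact MulChar.orderOf_dvd_card_sub_one _ θ
  rw [← Fintype.card_units] at hd
  obtain ⟨x, hx⟩ := exists_prime_orderOf_dvd_card 3 hd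
  have hx3 : x ^ 3 = 1 := by rw [← hx]; exact pow_orderOf_eq_one x
  have hx1 : x ≠ 1 := by rintro rfl; simp at hx
  refine ⟨x, ?_⟩
  have h3 : (x : F) ^ 3 = 1 := by
    have := congrArg Units.val hx3
    simpa using this
  have h4 : (x : F) - 1 ≠ 0 := by
    rw [sub_ne_zero]; simpa using hx1
  apply mul_left_cancel₀ h4
  linear_combination h3

/-- The set of roots, split case. -/
lemma cubic_split (h2 : (2 : F) ≠ 0) (h3 : (3 : F) ≠ 0) {θ : MulChar F ℂ} (h1 : θ ≠ 1)
    (hθ : θ ^ 3 = 1) {y : F} (hy : y ≠ 0) :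
    ((Finset.univ.filter (fun u : F => u ^ 3 - 3 * u = y + y⁻¹)).card : ℂ) =
      1 + ∑ z ∈ Finset.univ.filter (fun z : F => z + z⁻¹ = y + y⁻¹), θ z := by
  obtain ⟨ζ, hζ⟩ := exists_zeta h1 hθ
  have hζ3 : ζ ^ 3 = 1 := by linear_combination (ζ - 1) * hζ
  have hζ0 : ζ ≠ 0 := by rintro rfl; simp at hζ
  have hζ1 : ζ - 1 ≠ 0 := by
    intro h
    apply h3
    have : ζ = 1 := by linear_combination h
    rw [this] at hζ
    linear_combination hζ
  have hsum : ∑ z ∈ Finset.univ.filter (fun z : F => z + z⁻¹ = y + y⁻¹), θ z =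
      ∑ z ∈ ({y, y⁻¹} : Finset F), θ z := by
    symm
    apply Finset.sum_subset
    · intro z hz
      simp only [Finset.mem_insert, Finset.mem_singleton] at hz
      rcases hz with rfl | rfl
      · simp
      · simp [add_comm]
    · intro z hz hz'
      by_cases hz0 : z = 0
      · rw [hz0, MulChar.map_zero]
      · exfalso
        apply hz'
        simp only [Finset.mem_insert, Finset.mem_singleton]
        exact add_inv_eq_iff hz0 hy (by simpa using hz)
  rw [hsum]
  by_cases hyy : y = y⁻¹
  · have hy2 : y ^ 2 = 1 := by
      rw [sq]; nth_rewrite 2 [hyy]; exact mul_inv_cancel₀ hy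
    rw [← hyy]
    have hθy : θ y = 1 := by
      have a := chi_unit_pow hθ hy
      have b : θ y ^ 2 = 1 := by rw [← map_pow, hy2, map_one]
      linear_combination a - θ y * b
    have : Finset.univ.filter (fun u : F => u ^ 3 - 3 * u = y + y) = {-y, 2 * y} := by
      ext u
      simp only [Finset.mem_filter, Finset.mem_univ, true_and, Finset.mem_insert,
        Finset.mem_singleton]
      constructor
      · intro h
        have : (u + y) ^ 2 * (u - 2 * y) = 0 := by linear_combination h + (- 3 * u - 2 * y) * hy2
        rcases mul_eq_zero.mp this with h | h
        · left; exact eq_neg_of_add_eq_zero_left (pow_eq_zero_iff two_ne_zero |>.mp h)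
        · right; exact sub_eq_zero.mp h
      · rintro (rfl | rfl)
        · linear_combination (-y) * hy2
        · linear_combination (8 * y) * hy2
    rw [this, Finset.card_pair]
    · simp [hθy]; norm_num
    · intro h
      have : 3 * y = 0 := by linear_combination -h
      simp [h3, hy] at this
  · rw [Finset.sum_pair hyy]
    have hy2 : y ^ 2 - 1 ≠ 0 := by
      intro h
      apply hyy
      field_simp
      linear_combination h
    by_cases hc : ∃ v : F, v ^ 3 = y
    · obtain ⟨v, rfl⟩ := hc
      have hv : v ≠ 0 := by rintro rfl; simp at hy
      have hθv : θ (v ^ 3) = 1 := by rw [map_pow, chi_unit_pow hθ hv]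
      have hθv' : θ (v ^ 3)⁻¹ = 1 := by
        rw [← MulChar.inv_apply', MulChar.inv_apply_eq_inv', hθv, inv_one]
      have : Finset.univ.filter (fun u : F => u ^ 3 - 3 * u = v ^ 3 + (v ^ 3)⁻¹) =
          {v + v⁻¹, ζ * v + ζ ^ 2 * v⁻¹, ζ ^ 2 * v + ζ * v⁻¹} := by
        obtain ⟨w, hw⟩ : ∃ w, w = v⁻¹ := ⟨_, rfl⟩
        have hvw : v * w = 1 := by rw [hw]; exact mul_inv_cancel₀ hv
        rw [← inv_pow, ← hw]
        ext u
        simp only [Finset.mem_filter, Finset.mem_univ, true_and, Finset.mem_insert,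
          Finset.mem_singleton]
        have key : (u - (v + w)) * ((u - (ζ * v + ζ ^ 2 * w)) * (u - (ζ ^ 2 * v + ζ * w))) =
            u ^ 3 - 3 * u - (v ^ 3 + w ^ 3) := by
          have hz2 : ζ ^ 2 = -ζ - 1 := by linear_combination hζ
          have e : (u - (ζ * v + ζ ^ 2 * w)) * (u - (ζ ^ 2 * v + ζ * w)) =
            u ^ 2 + u * (v + w) + v ^ 2 + w ^ 2 - v * w := by
            linear_combination (-u * v - u * w + v*w*(ζ^2 - ζ +1)) * hζ + (v^2+w^2)*hζ3
          rw [e]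
          linear_combination (-3 * u) * hvw
        constructor
        · intro h
          have : (u - (v + w)) * ((u - (ζ * v + ζ ^ 2 * w)) * (u - (ζ ^ 2 * v + ζ * w))) = 0 := by
            rw [key]; linear_combination h
          rcases mul_eq_zero.mp this with h | h
          · left; exact sub_eq_zero.mp h
          rcases mul_eq_zero.mp h with h | h
          · right; left; exact sub_eq_zero.mp h
          · right; right; exact sub_eq_zero.mp h
        · intro h
          have : (u - (v + w)) * ((u - (ζ * v + ζ ^ 2 * w)) * (u - (ζ ^ 2 * v + ζ * w))) = 0 := by
            rcases h with h | h | h <;> rw [h] <;> ring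
          rw [key] at this
          linear_combination this
      rw [this, hθv, hθv', Finset.card_insert_of_notMem, Finset.card_pair]
      · norm_num
      · intro h
        apply hy2
        have hh : (ζ - 1) * (v ^ 2 - 1) = 0 := by
          field_simp at h
          linear_combination (-1 : F) * h
        have hv2 : v ^ 2 = 1 := by
          have : v ^ 2 - 1 = 0 := (mul_eq_zero.mp hh).resolve_left hζ1
          linear_combination this
        calc (v ^ 3) ^ 2 - 1 = (v ^ 2) ^ 3 - 1 := by ring
          _ = 0 := by rw [hv2]; ring
      · simp only [Finset.mem_insert, Finset.mem_singleton]
        rintro (h | h)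
        · apply hy2
          have hh : (ζ - 1) * (v ^ 2 + (ζ + 1)) = 0 := by
            field_simp at h
            linear_combination (-1 : F) * h
          have hv2 : v ^ 2 = ζ ^ 2 := by
            have : v ^ 2 + (ζ + 1) = 0 := by simpa [hζ1] using hh
            linear_combination this - hζ
          calc (v ^ 3) ^ 2 - 1 = (v ^ 2) ^ 3 - 1 := by ring
            _ = 0 := by rw [hv2]; linear_combination (ζ ^ 3 + 1) * hζ3
        · apply hy2
          have hh : (ζ - 1) * ((ζ + 1) * v ^ 2 + 1) = 0 := by
            field_simp at h
            linear_combination (-1 : F) * h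
          have hv2 : v ^ 2 = ζ := by
            have : (ζ + 1) * v ^ 2 + 1 = 0 := by simpa [hζ1] using hh
            linear_combination (-ζ) * this + (v ^ 2) * hζ
          calc (v ^ 3) ^ 2 - 1 = (v ^ 2) ^ 3 - 1 := by ring
            _ = 0 := by rw [hv2, hζ3]; ring
    · have hθ1 : θ y ≠ 1 := fun h => hc (char_prime_pow_iff Nat.prime_three h1 hθ hy h)
      have hθy := chi_unit_pow hθ hy
      have hne : θ y ≠ 0 := chi_ne_zero θ hy
      have hθ' : θ y⁻¹ = θ y ^ 2 := by
        rw [← MulChar.inv_apply', MulChar.inv_apply_eq_inv']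
        field_simp
        exact hθy.symm
      have h0 : 1 + (θ y + θ y ^ 2) = 0 := by
        apply mul_left_cancel₀ (sub_ne_zero.mpr hθ1)
        linear_combination hθy
      rw [hθ', h0]
      have : Finset.univ.filter (fun u : F => u ^ 3 - 3 * u = y + y⁻¹) = ∅ := by
        rw [Finset.filter_eq_empty_iff]
        intro u _ hu
        obtain ⟨w, hw⟩ : ∃ w, w = y⁻¹ := ⟨_, rfl⟩
        have hyw : y * w = 1 := by rw [hw]; exact mul_inv_cancel₀ hy
        have hyw' : y - w ≠ 0 := by rw [hw]; exact sub_ne_zero.mpr hyy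
        rw [← hw] at hu
        have hs : (u ^ 2 - 4) * (u ^ 2 - 1) ^ 2 = (y - w) ^ 2 := by
          linear_combination (u ^ 3 - 3 * u + y + w) * hu + 4 * hyw
        have hu1 : u ^ 2 - 1 ≠ 0 := by
          intro h
          rw [h] at hs
          apply hyw'
          apply pow_eq_zero_iff two_ne_zero |>.mp
          rw [← hs]; ring
        obtain ⟨r, hr⟩ : ∃ r, r = (y - w) / (u ^ 2 - 1) := ⟨_, rfl⟩
        have hr2 : r ^ 2 = u ^ 2 - 4 := by
          rw [hr, div_pow, ← hs]; field_simp
        obtain ⟨v, hv⟩ : ∃ v, v = (u + r) / 2 := ⟨_, rfl⟩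
        have hvu : v * (u - v) = 1 := by
          rw [hv]; field_simp
          linear_combination (-1 : F) * hr2
        have hv0 : v ≠ 0 := by rintro rfl; simp at hvu
        have hvi : v⁻¹ = u - v := by
          rw [inv_eq_iff_eq_inv, ← one_div, eq_div_iff]
          · exact hvu
          · intro h; rw [h] at hvu; simp at hvu
        have hvy : v ^ 3 + (v ^ 3)⁻¹ = y + y⁻¹ := by
          rw [← inv_pow, hvi, ← hw, ← hu]
          linear_combination (-3 * u) * hvu
        rcases add_inv_eq_iff (pow_ne_zero 3 hv0) hy hvy with h | h
        · exact hc ⟨v, h⟩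
        · exact hc ⟨v⁻¹, by rw [inv_pow, h, inv_inv]⟩
      rw [this]; simp

lemma cubic_nonsplit (h2 : (2 : F) ≠ 0) (h3 : (3 : F) ≠ 0) {θ : MulChar F ℂ} (h1 : θ ≠ 1)
    (hθ : θ ^ 3 = 1) {s : F} (hs : ∀ y : F, y ≠ 0 → y + y⁻¹ ≠ s) :
    (Finset.univ.filter (fun u : F => u ^ 3 - 3 * u = s)).card ≤ 1 := by
  obtain ⟨ζ, hζ⟩ := exists_zeta h1 hθ
  rw [Finset.card_le_one]
  intro u hu w hw
  simp only [Finset.mem_filter, Finset.mem_univ, true_and] at hu hw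
  by_contra hne
  have e : u ^ 2 + u * w + w ^ 2 = 3 := by
    apply mul_left_cancel₀ (sub_ne_zero.mpr hne)
    linear_combination hu - hw
  have hd2 : (2 * ζ + 1) ^ 2 = -3 := by linear_combination 4 * hζ
  have hd : 2 * ζ + 1 ≠ 0 := by
    intro h; rw [h] at hd2; apply h3; linear_combination hd2
  obtain ⟨r, hr⟩ : ∃ r, r = (2 * w + u) / (2 * ζ + 1) := ⟨_, rfl⟩
  have hr2 : r ^ 2 = u ^ 2 - 4 := by
    rw [hr, div_pow, hd2, div_eq_iff (by simpa using h3)]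
    linear_combination 4 * e
  obtain ⟨v, hv⟩ : ∃ v, v = (u + r) / 2 := ⟨_, rfl⟩
  have hvu : v * (u - v) = 1 := by
    rw [hv]; field_simp
    linear_combination (-1 : F) * hr2
  have hv0 : v ≠ 0 := by rintro rfl; simp at hvu
  have hvi : v⁻¹ = u - v := by
    rw [inv_eq_iff_eq_inv, ← one_div, eq_div_iff]
    · exact hvu
    · intro h; rw [h] at hvu; simp at hvu
  apply hs (v ^ 3) (pow_ne_zero 3 hv0)
  rw [← inv_pow, hvi, ← hu]
  linear_combination (-3 * u) * hvu

lemma cubic_count (h2 : (2 : F) ≠ 0) (h3 : (3 : F) ≠ 0) {θ : MulChar F ℂ} (h1 : θ ≠ 1)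
    (hθ : θ ^ 3 = 1) (s : F) :
    ((Finset.univ.filter (fun u : F => u ^ 3 - 3 * u = s)).card : ℂ) =
      1 + ∑ z ∈ Finset.univ.filter (fun z : F => z + z⁻¹ = s), θ z := by
  have hm : ∀ s : F, ∃ m : ℕ, (m : ℂ) = 1 + (∑ z ∈ Finset.univ.filter (fun z : F => z + z⁻¹ = s), θ z)
      - ((Finset.univ.filter (fun u : F => u ^ 3 - 3 * u = s)).card : ℂ) := by
    intro s
    by_cases hs : ∃ y : F, y ≠ 0 ∧ y + y⁻¹ = s
    · obtain ⟨y, hy, rfl⟩ := hs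
      refine ⟨0, ?_⟩
      rw [cubic_split h2 h3 h1 hθ hy]; simp
    · push Not at hs
      have hle := cubic_nonsplit h2 h3 h1 hθ hs
      refine ⟨1 - (Finset.univ.filter (fun u : F => u ^ 3 - 3 * u = s)).card, ?_⟩
      rw [Finset.sum_eq_zero, Nat.cast_sub hle]
      · simp
      · intro z hz
        by_cases hz0 : z = 0
        · rw [hz0, MulChar.map_zero]
        · exact absurd (Finset.mem_filter.mp hz).2 (hs z hz0)
  choose m hm using hm
  have hsum : ∑ s, (m s : ℂ) = 0 := by
    rw [Finset.sum_congr rfl (fun s _ => hm s), Finset.sum_sub_distrib, Finset.sum_add_distrib,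
      Finset.sum_fiberwise (s := Finset.univ) (g := fun z : F => z + z⁻¹) (f := fun z => θ z), MulChar.sum_eq_zero_of_ne_one h1]
    have := sum_fiber (F := F) (f := fun u => u ^ 3 - 3 * u) (h := fun _ => 1)
    simp only [mul_one] at this
    rw [← this]; simp
  have hz : ∑ s, m s = 0 := by exact_mod_cast hsum
  have := hm s
  rw [Finset.sum_eq_zero_iff.mp hz s (Finset.mem_univ s)] at this
  simp only [Nat.cast_zero] at this
  linear_combination this

end cubic

section davenport

set_option linter.unusedSectionVars false

variable {F : Type} [Field F] [Fintype F]

/-- The bijection `y ↦ y / (1 + y)` (with `-1 ↦ 1`). -/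
noncomputable def mobEquiv (F : Type) [Field F] : F ≃ F where
  toFun y := if y = -1 then 1 else y / (1 + y)
  invFun x := if x = 1 then -1 else x / (1 - x)
  left_inv y := by
    by_cases h : y = -1
    · simp [h]
    · have h1 : 1 + y ≠ 0 := fun h' => h (by linear_combination h')
      have h2 : y / (1 + y) ≠ 1 := by
        intro h3
        rw [div_eq_iff h1] at h3
        apply one_ne_zero (α := F)
        linear_combination -h3
      simp only [h, h2, if_false]
      have h4 : 1 - y / (1 + y) = 1 / (1 + y) := by field_simp; ring
      rw [h4]; field_simp
  right_inv x := by
    by_cases h : x = 1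
    · simp [h]
    · have h1 : 1 - x ≠ 0 := fun h' => h (by linear_combination -h')
      have h2 : x / (1 - x) ≠ -1 := by
        intro h3
        rw [div_eq_iff h1] at h3
        apply one_ne_zero (α := F)
        linear_combination h3
      simp only [h, h2, if_false]
      have h4 : 1 + x / (1 - x) = 1 / (1 - x) := by field_simp; ring
      rw [h4]; field_simp

/-- Jacobi sum form of the cubic Hasse-Davenport relation -/
lemma jac3 (h2 : (2 : F) ≠ 0) (h3 : (3 : F) ≠ 0) {θ : MulChar F ℂ} (h1 : θ ≠ 1) (hθ : θ ^ 3 = 1)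
    {χ : MulChar F ℂ} (hχ : χ ≠ 1) :
    χ 27 * jacobiSum (χ * θ) (χ * θ⁻¹) = jacobiSum (χ⁻¹ * χ⁻¹) χ⁻¹ := by
  have e1 : jacobiSum (χ * θ) (χ * θ⁻¹) = ∑ y : F, θ y * χ⁻¹ (y + y⁻¹ + 2) := by
    unfold jacobiSum
    refine (Fintype.sum_equiv (mobEquiv F) _ _ ?_).symm
    intro y
    by_cases h : y = -1
    · subst h
      have a : (-1 : F) + (-1)⁻¹ + 2 = 0 := by rw [inv_neg, inv_one]; ring
      simp only [mobEquiv, Equiv.coe_fn_mk, if_true, sub_self, MulChar.map_zero, mul_zero, a]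
    by_cases hy : y = 0
    · subst hy
      have h' : ¬ (0 : F) = -1 := h
      simp only [mobEquiv, Equiv.coe_fn_mk, h', if_false, zero_div, MulChar.map_zero, zero_mul]
    have hy1 : 1 + y ≠ 0 := fun h' => h (by linear_combination h')
    simp only [mobEquiv, Equiv.coe_fn_mk, h, if_false]
    have a : 1 - y / (1 + y) = (1 + y)⁻¹ := by field_simp; ring
    have b : y + y⁻¹ + 2 = y⁻¹ * ((1 + y) * (1 + y)) := by field_simp; ring
    rw [a, b, div_eq_mul_inv]
    simp only [MulChar.mul_apply, map_mul, ← MulChar.inv_apply', inv_inv]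
    have c1 := chi_ne_zero θ hy1
    have c2 := chi_ne_zero χ hy1
    simp only [MulChar.inv_apply_eq_inv', MulChar.mul_apply]
    field_simp
  have e2 : ∑ y : F, θ y * χ⁻¹ (y + y⁻¹ + 2) =
      ∑ s : F, (((Finset.univ.filter (fun u : F => u ^ 3 - 3 * u = s)).card : ℂ) * χ⁻¹ (s + 2)
        - χ⁻¹ (s + 2)) := by
    rw [← Finset.sum_fiberwise (s := Finset.univ) (g := fun y : F => y + y⁻¹)]
    refine Finset.sum_congr rfl fun s _ => ?_
    rw [cubic_count h2 h3 h1 hθ, add_mul, one_mul, add_sub_cancel_left, Finset.sum_mul]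
    refine Finset.sum_congr rfl fun y hy => ?_
    rw [(Finset.mem_filter.mp hy).2]
  rw [e1, e2, Finset.sum_sub_distrib, ← sum_fiber (f := fun u => u ^ 3 - 3 * u)
    (h := fun s => χ⁻¹ (s + 2))]
  have e3 : ∑ s : F, χ⁻¹ (s + 2) = 0 := by
    rw [← MulChar.sum_eq_zero_of_ne_one (inv_ne_one.mpr hχ)]
    exact Fintype.sum_equiv (Equiv.addRight (2 : F)) _ _ (fun x => rfl)
  rw [e3, sub_zero, Finset.mul_sum]
  unfold jacobiSum
  have h3' : (-3 : F) ≠ 0 := by simpa using h3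
  refine (Fintype.sum_equiv ((Equiv.mulRight₀ (-3 : F) h3').trans (Equiv.addRight (1 : F))) _ _ ?_).symm
  intro z
  change (χ⁻¹ * χ⁻¹) z * χ⁻¹ (1 - z) = χ 27 * χ⁻¹ ((z * (-3) + 1) ^ 3 - 3 * (z * (-3) + 1) + 2)
  have a : (z * (-3) + 1) ^ 3 - 3 * (z * (-3) + 1) + 2 = 27 * (z * z * (1 - z)) := by ring
  have h27 : (27 : F) ≠ 0 := by
    have : (27 : F) = 3 ^ 3 := by norm_num
    rw [this]; exact pow_ne_zero _ h3
  rw [a, MulChar.mul_apply, map_mul _ (27 : F), map_mul, map_mul, MulChar.inv_apply_eq_inv' χ 27,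
    ← mul_assoc, mul_inv_cancel₀ (chi_ne_zero χ h27), one_mul]

lemma chi_neg_one_cubic {θ : MulChar F ℂ} (hθ : θ ^ 3 = 1) : θ (-1) = 1 := by
  have a := chi_unit_pow hθ (a := -1) (by simp)
  have b := chi_neg_one_sq θ
  linear_combination a - θ (-1) * b

lemma cubic_cases {θ : MulChar F ℂ} (h1 : θ ≠ 1) (hθ : θ ^ 3 = 1) {χ : MulChar F ℂ}
    (hχ : χ ^ 3 = 1) : χ = 1 ∨ χ = θ ∨ χ = θ⁻¹ := by
  obtain ⟨g, hg⟩ := IsCyclic.exists_generator (α := Fˣ)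
  have hgn : θ g ≠ 1 := by
    intro h2
    apply h1
    rw [MulChar.eq_iff hg, h2, MulChar.one_apply_coe]
  have a : θ g ^ 3 = 1 := chi_unit_pow hθ g.ne_zero
  have b : χ g ^ 3 = 1 := chi_unit_pow hχ g.ne_zero
  have c : θ g ^ 2 + θ g + 1 = 0 := by
    apply mul_left_cancel₀ (sub_ne_zero.mpr hgn)
    linear_combination a
  have d : (χ g - 1) * ((χ g - θ g) * (χ g - θ g ^ 2)) = 0 := by
    linear_combination b - χ g ^ 2 * c + χ g * θ g * c + χ g * (c - a)- χ g * c + χ g * a - a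
  rcases mul_eq_zero.mp d with d | d
  · left
    rw [MulChar.eq_iff hg, MulChar.one_apply_coe]; linear_combination d
  rcases mul_eq_zero.mp d with d | d
  · right; left
    rw [MulChar.eq_iff hg]; linear_combination d
  · right; right
    rw [MulChar.eq_iff hg, MulChar.inv_apply_eq_inv', ← one_div, eq_div_iff (chi_ne_zero θ g.ne_zero)]
    linear_combination d * θ g + a

/-- Hasse-Davenport for 3 -/
lemma hd3 {ψ : AddChar F ℂ} (hψ : ψ.IsPrimitive) (h2 : (2 : F) ≠ 0) (h3 : (3 : F) ≠ 0)
    {θ : MulChar F ℂ} (h1 : θ ≠ 1) (hθ : θ ^ 3 = 1) (χ : MulChar F ℂ) :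
    gaussSum χ ψ * gaussSum (χ * θ) ψ * gaussSum (χ * θ⁻¹) ψ * χ 27 =
      Fintype.card F * gaussSum (χ ^ 3) ψ := by
  have h27' : (27 : F) = 3 ^ 3 := by norm_num
  have h27 : (27 : F) ≠ 0 := by rw [h27']; exact pow_ne_zero _ h3
  have hθ2 : θ * θ = θ⁻¹ := by
    rw [eq_inv_iff_mul_eq_one, ← hθ, pow_three']
  have hθ2' : θ⁻¹ * θ⁻¹ = θ := by rw [← mul_inv, hθ2, inv_inv]
  have gθ := gs_inv hψ h1
  rw [chi_neg_one_cubic hθ, one_mul] at gθ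
  by_cases hc3 : χ ^ 3 = 1
  · have e27 : χ 27 = 1 := by rw [h27', map_pow, chi_unit_pow hc3 h3]
    rw [e27, hc3, gs_one hψ]
    rcases cubic_cases h1 hθ hc3 with rfl | rfl | rfl
    · rw [one_mul, one_mul, gs_one hψ]; linear_combination -gθ
    · rw [hθ2, mul_inv_cancel, gs_one hψ]; linear_combination -gθ
    · rw [hθ2', inv_mul_cancel, gs_one hψ]; linear_combination -gθ
  have hχ : χ ≠ 1 := by rintro rfl; simp at hc3
  have j := jac3 h2 h3 h1 hθ hχ
  have gχ := gs_inv hψ hχ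
  by_cases hc2 : χ * χ = 1
  · have hi : χ⁻¹ = χ := inv_eq_of_mul_eq_one_left hc2
    have hθχ : χ * θ ≠ 1 := by
      intro h
      apply hc3
      have : χ = θ⁻¹ := eq_inv_of_mul_eq_one_left h
      rw [this, inv_pow, hθ, inv_one]
    have hiθ : χ * θ⁻¹ = (χ * θ)⁻¹ := by rw [mul_inv, hi]
    rw [hi, hc2, jacobiSum_one_nontrivial hχ, hiθ, jacobiSum_nontrivial_inv hθχ,
      MulChar.mul_apply, chi_neg_one_cubic hθ] at j
    have g1 := gs_inv hψ hθχ
    rw [MulChar.mul_apply, chi_neg_one_cubic hθ] at g1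
    have : χ ^ 3 = χ := by
      calc χ ^ 3 = (χ * χ) * χ := pow_three' χ
        _ = χ := by rw [hc2, one_mul]
    rw [this, hiθ]
    linear_combination gaussSum χ ψ * χ 27 * g1 - (Fintype.card F) * gaussSum χ ψ * j
  · have hp : (χ * θ) * (χ * θ⁻¹) = χ * χ := by
      rw [mul_mul_mul_comm, mul_inv_cancel, mul_one]
    have g1 := jacobiSum_mul_nontrivial (χ := χ * θ) (φ := χ * θ⁻¹) (by rwa [hp]) ψ
    rw [hp] at g1
    have hp3 : χ⁻¹ * χ⁻¹ * χ⁻¹ = (χ ^ 3)⁻¹ := by rw [← inv_pow, pow_three']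
    have g2 := jacobiSum_mul_nontrivial (χ := χ⁻¹ * χ⁻¹) (φ := χ⁻¹)
      (by rw [hp3]; exact inv_ne_one.mpr hc3) ψ
    rw [hp3] at g2
    have g3 := gs_inv hψ hc2
    have g4 := gs_inv hψ hc3
    rw [MulChar.mul_apply, chi_neg_one_sq, mul_inv] at g3
    have hm : (χ ^ 3) (-1) = χ (-1) := by
      rw [chi_pow_app χ 3 (by simp)]
      linear_combination χ (-1) * chi_neg_one_sq χ
    rw [hm] at g4
    apply mul_left_cancel₀ (gs_ne_zero hψ (χ ^ 3)⁻¹)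
    linear_combination (-gaussSum (χ ^ 3)⁻¹ ψ * gaussSum χ ψ * χ 27) * g1 +
      gaussSum (χ ^ 3)⁻¹ ψ * gaussSum χ ψ * gaussSum (χ * χ) ψ * j +
      gaussSum χ ψ * gaussSum (χ * χ) ψ * g2 + gaussSum χ ψ * gaussSum χ⁻¹ ψ * g3 +
      (Fintype.card F) * gχ - (Fintype.card F) * g4

/-- Hasse-Davenport for 6 -/
lemma hd6 {ψ : AddChar F ℂ} (hψ : ψ.IsPrimitive) (h2 : (2 : F) ≠ 0) (h3 : (3 : F) ≠ 0)
    {θ φ : MulChar F ℂ} (h1 : θ ≠ 1) (hθ : θ ^ 3 = 1) (h1' : φ ≠ 1) (hφ : φ ^ 2 = 1)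
    (χ : MulChar F ℂ) :
    gaussSum χ ψ * gaussSum (χ * φ) ψ * (gaussSum (χ * θ) ψ * gaussSum (χ * θ * φ) ψ) *
      (gaussSum (χ * θ⁻¹) ψ * gaussSum (χ * θ⁻¹ * φ) ψ) * χ 6 ^ 6 =
      φ (-1) * Fintype.card F ^ 2 * gaussSum φ ψ * gaussSum (χ ^ 6) ψ := by
  have a1 := hd2 hψ h2 h1' hφ χ
  have a2 := hd2 hψ h2 h1' hφ (χ * θ)
  have a3 := hd2 hψ h2 h1' hφ (χ * θ⁻¹)
  have b := hd3 hψ h2 h3 h1 hθ (χ ^ 2)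
  have hθ2 : θ ^ 2 = θ⁻¹ := by
    rw [eq_inv_iff_mul_eq_one, ← hθ, pow_succ θ 2]
  have hθ2' : θ⁻¹ ^ 2 = θ := by rw [inv_pow, hθ2, inv_inv]
  have h4 : (4 : F) ≠ 0 := by
    have : (4 : F) = 2 ^ 2 := by norm_num
    rw [this]; exact pow_ne_zero _ h2
  have h27' : (27 : F) = 3 ^ 3 := by norm_num
  have h27 : (27 : F) ≠ 0 := by rw [h27']; exact pow_ne_zero _ h3
  have hθ4 : θ 4 * θ⁻¹ 4 = 1 := by
    rw [MulChar.inv_apply_eq_inv', mul_inv_cancel₀ (chi_ne_zero θ h4)]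
  rw [mul_pow, hθ2, MulChar.mul_apply] at a2
  rw [mul_pow, hθ2', MulChar.mul_apply] at a3
  have h6 : χ 6 ^ 6 = χ 4 ^ 3 * (χ ^ 2) 27 := by
    rw [chi_pow_app χ 2 h27, ← map_pow, ← map_pow, ← map_pow, ← map_mul]
    norm_num
  have hφi : φ⁻¹ = φ := by
    apply inv_eq_of_mul_eq_one_left; rw [← sq, hφ]
  have gφ := gs_inv hψ h1'
  rw [hφi] at gφ
  rw [← pow_mul] at b
  rw [h6]
  norm_num at b
  generalize gaussSum (χ * φ) ψ = x1 at *
  generalize gaussSum (χ * θ) ψ = x2 at *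
  generalize gaussSum (χ * θ * φ) ψ = x3 at *
  generalize gaussSum (χ * θ⁻¹) ψ = x4 at *
  generalize gaussSum (χ * θ⁻¹ * φ) ψ = x5 at *
  generalize gaussSum χ ψ = x0 at *
  generalize gaussSum φ ψ = xφ at *
  generalize gaussSum (χ ^ 2) ψ = y0 at *
  generalize gaussSum (χ ^ 2 * θ) ψ = y1 at *
  generalize gaussSum (χ ^ 2 * θ⁻¹) ψ = y2 at *
  generalize gaussSum (χ ^ 6) ψ = z at *
  have m : x0 * x1 * χ 4 * (x2 * x3 * (χ 4 * θ 4)) * (x4 * x5 * (χ 4 * θ⁻¹ 4)) =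
     y0 * xφ * (y2 * xφ) * (y1 * xφ) := by rw [a1, a2, a3]
  linear_combination (χ ^ 2) 27 * m - x0 * x1 * x2 * x3 * x4 * x5 * χ 4 ^ 3 * (χ ^ 2) 27 * hθ4 +
    xφ ^ 3 * b + (Fintype.card F) * z * xφ * gφ

end davenport

section mainsum

set_option linter.unusedSectionVars false

variable {F : Type} [Field F] [Fintype F]

/-- The additive character `x ↦ exp(2πi tr(x)/p)`. -/
noncomputable def trChar (p : ℕ) [Fact p.Prime] (F : Type) [Field F] [Algebra (ZMod p) F] :
    AddChar F ℂ :=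
  (ZMod.stdAddChar (N := p)).compAddMonoidHom (Algebra.trace (ZMod p) F).toAddMonoidHom

lemma gaussChar_eq (p : ℕ) [Fact p.Prime] [Algebra (ZMod p) F] (χ : MulChar F ℂ) :
    gaussChar p F χ = gaussSum χ (trChar p F) := by
  unfold gaussChar gaussSum
  refine Finset.sum_congr rfl fun x _ => ?_
  congr 1
  have := ZMod.toCircle_apply (N := p) (Algebra.trace (ZMod p) F x)
  rw [← this]
  rfl

lemma trChar_primitive (p : ℕ) [Fact p.Prime] [Algebra (ZMod p) F] : (trChar p F).IsPrimitive := by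
  apply AddChar.IsPrimitive.of_ne_one
  intro h
  obtain ⟨x, hx⟩ := Algebra.trace_surjective (ZMod p) F 1
  have h1 : trChar p F x = 1 := by rw [h]; rfl
  have h2 : ZMod.stdAddChar (N := p) 1 = 1 := by rw [← hx]; exact h1
  have h3 : ZMod.stdAddChar (N := p) 1 = ZMod.stdAddChar (N := p) 0 := by
    rw [h2, AddChar.map_zero_eq_one]
  exact one_ne_zero (ZMod.injective_stdAddChar h3)

lemma orth {ω : MulChar F ℂ} (hω : ∀ χ : MulChar F ℂ, ∃ j : ℕ, χ = ω ^ j) (a : F) :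
    ∑ j ∈ Finset.range (Fintype.card F - 1), (ω ^ j) a =
      if a = 1 then ((Fintype.card F : ℂ) - 1) else 0 := by
  have hc : 1 ≤ Fintype.card F := Fintype.card_pos
  by_cases h0 : a = 0
  · subst h0
    simp [MulChar.map_zero]
  by_cases h1 : a = 1
  · subst h1
    simp [Nat.cast_sub hc]
  rw [if_neg h1, Finset.sum_congr rfl (fun j _ => chi_pow_app ω j h0)]
  have hne : ω a ≠ 1 := by
    intro h
    obtain ⟨χ, hχ⟩ := MulChar.exists_apply_ne_one_of_hasEnoughRootsOfUnity F ℂ h1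
    obtain ⟨j, rfl⟩ := hω χ
    apply hχ
    rw [chi_pow_app ω j h0, h, one_pow]
  rw [geom_sum_eq hne, ← map_pow, FiniteField.pow_card_sub_one_eq_one a h0]
  simp

/-- the reduced double sum -/
lemma inner_sum_x {θ φ : MulChar F ℂ} {L : F} (hL : L ≠ 0) (hθL : θ L = 1) (y : F) :
    ∑ x : F, (if x * y * L * (1 - x)⁻¹ * (1 - y)⁻¹ = 1 then
      θ (1 - x) * φ y * θ⁻¹ (1 - y) else 0) =
      φ y * θ y * θ⁻¹ (1 - y) * θ⁻¹ (1 - y + y * L) := by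
  by_cases hy : y = 0
  · subst hy; simp [MulChar.map_zero]
  by_cases hy1 : 1 - y = 0
  · rw [hy1]; simp [MulChar.map_zero]
  by_cases hM : 1 - y + y * L = 0
  · rw [hM, MulChar.map_zero, mul_zero]
    apply Finset.sum_eq_zero
    intro x _
    rw [if_neg]
    intro h
    by_cases hx : 1 - x = 0
    · rw [hx] at h; simp at h
    field_simp at h
    apply hy1
    linear_combination x * hM - h
  rw [Finset.sum_eq_single ((1 - y) / (1 - y + y * L))]
  · have e : 1 - (1 - y) / (1 - y + y * L) = y * L * (1 - y + y * L)⁻¹ := by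
      field_simp; ring
    rw [e, if_pos]
    · rw [map_mul, map_mul, hθL, ← MulChar.inv_apply']; ring
    · field_simp
  · intro x _ hx
    rw [if_neg]
    intro h
    by_cases hx' : 1 - x = 0
    · rw [hx'] at h; simp at h
    field_simp at h
    apply hx
    rw [eq_div_iff hM]
    linear_combination h
  · simp

lemma greene_sum {θ φ : MulChar F ℂ} (hθ : θ ^ 3 = 1) (hφ : φ ^ 2 = 1) {L : F} (hL : L ≠ 0)
    (hθL : θ L = 1) :
    ∑ y : F, θ⁻¹ y * ((θ⁻¹)⁻¹ * φ) (1 - y) * θ⁻¹ (1 - L⁻¹ * y) =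
      ∑ y : F, φ y * θ y * θ⁻¹ (1 - y) * θ⁻¹ (1 - y + y * L) := by
  refine (Fintype.sum_equiv ((Equiv.inv F).trans (Equiv.subLeft (1 : F))) _ _ ?_).symm
  intro y
  change _ = θ⁻¹ (1 - y⁻¹) * ((θ⁻¹)⁻¹ * φ) (1 - (1 - y⁻¹)) * θ⁻¹ (1 - L⁻¹ * (1 - y⁻¹))
  by_cases hy : y = 0
  · subst hy; simp [MulChar.map_zero]
  have e1 : 1 - y⁻¹ = (-1) * (1 - y) * y⁻¹ := by field_simp; ring
  have e2 : 1 - L⁻¹ * (1 - y⁻¹) = (1 - y + y * L) * (L⁻¹ * y⁻¹) := by field_simp; ring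
  have e3 : 1 - (1 - y⁻¹) = y⁻¹ := by ring
  have c1 := chi_ne_zero θ hy
  have c2 := chi_ne_zero φ hy
  have c3 := chi_unit_pow hθ hy
  have c4 := chi_unit_pow hφ hy
  have c5 : φ y⁻¹ = φ y := by
    rw [← MulChar.inv_apply', MulChar.inv_apply_eq_inv']
    field_simp
    exact c4.symm
  rw [e2, e3, e1, inv_inv]
  simp only [map_mul, MulChar.mul_apply, ← MulChar.inv_apply' θ⁻¹, inv_inv, hθL, c5,
    ← MulChar.inv_apply' θ]
  simp only [MulChar.inv_apply_eq_inv', chi_neg_one_cubic hθ]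
  field_simp

lemma main_sum {ψ : AddChar F ℂ} {ω : MulChar F ℂ}
    (hω : ∀ χ : MulChar F ℂ, ∃ j : ℕ, χ = ω ^ j) {θ φ : MulChar F ℂ} (h1 : θ ≠ 1)
    (hφθ : φ * θ⁻¹ ≠ 1) {L : F} (hL : L ≠ 0) (hθL : θ L = 1) :
    ∑ j ∈ Finset.range (Fintype.card F - 1),
      gaussSum (ω ^ j) ψ * gaussSum (ω ^ j * φ) ψ * gaussSum ((ω ^ j)⁻¹ * θ) ψ *
        gaussSum ((ω ^ j)⁻¹ * θ⁻¹) ψ * (ω ^ j) L =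
      ((Fintype.card F : ℂ) - 1) * gaussSum θ ψ * gaussSum (φ * θ⁻¹) ψ *
        ∑ y : F, φ y * θ y * θ⁻¹ (1 - y) * θ⁻¹ (1 - y + y * L) := by
  have step : ∀ j : ℕ, gaussSum (ω ^ j) ψ * gaussSum (ω ^ j * φ) ψ * gaussSum ((ω ^ j)⁻¹ * θ) ψ *
        gaussSum ((ω ^ j)⁻¹ * θ⁻¹) ψ * (ω ^ j) L =
      gaussSum θ ψ * gaussSum (φ * θ⁻¹) ψ * ∑ y : F, ∑ x : F,
        (ω ^ j) (x * y * L * (1 - x)⁻¹ * (1 - y)⁻¹) * (θ (1 - x) * φ y * θ⁻¹ (1 - y)) := by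
    intro j
    generalize ω ^ j = χ
    have p1 : χ * (χ⁻¹ * θ) = θ := by rw [mul_inv_cancel_left]
    have p2 : χ * φ * (χ⁻¹ * θ⁻¹) = φ * θ⁻¹ := by
      rw [mul_mul_mul_comm, mul_inv_cancel, one_mul]
    have g1 := jacobiSum_mul_nontrivial (χ := χ) (φ := χ⁻¹ * θ) (by rwa [p1]) ψ
    have g2 := jacobiSum_mul_nontrivial (χ := χ * φ) (φ := χ⁻¹ * θ⁻¹) (by rwa [p2]) ψ
    rw [p1] at g1
    rw [p2] at g2
    have e : jacobiSum χ (χ⁻¹ * θ) * jacobiSum (χ * φ) (χ⁻¹ * θ⁻¹) * χ L =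
        ∑ y : F, ∑ x : F,
        χ (x * y * L * (1 - x)⁻¹ * (1 - y)⁻¹) * (θ (1 - x) * φ y * θ⁻¹ (1 - y)) := by
      unfold jacobiSum
      rw [Finset.sum_mul_sum, Finset.sum_comm, Finset.sum_mul]
      refine Finset.sum_congr rfl fun y _ => ?_
      rw [Finset.sum_mul]
      refine Finset.sum_congr rfl fun x _ => ?_
      simp only [map_mul, MulChar.mul_apply, ← MulChar.inv_apply' χ]
      ring
    rw [← e]
    linear_combination (-χ L * gaussSum (χ * φ) ψ * gaussSum (χ⁻¹ * θ⁻¹) ψ) * g1 -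
      (χ L * gaussSum θ ψ * jacobiSum χ (χ⁻¹ * θ)) * g2
  rw [Finset.sum_congr rfl (fun j _ => step j), ← Finset.mul_sum, Finset.sum_comm]
  have : ∀ y : F, ∑ j ∈ Finset.range (Fintype.card F - 1), ∑ x : F,
        (ω ^ j) (x * y * L * (1 - x)⁻¹ * (1 - y)⁻¹) * (θ (1 - x) * φ y * θ⁻¹ (1 - y)) =
      ((Fintype.card F : ℂ) - 1) * (φ y * θ y * θ⁻¹ (1 - y) * θ⁻¹ (1 - y + y * L)) := by
    intro y
    rw [← inner_sum_x hL hθL y, Finset.sum_comm, Finset.mul_sum]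
    refine Finset.sum_congr rfl fun x _ => ?_
    rw [← Finset.sum_mul, orth hω]
    split_ifs <;> simp
  rw [Finset.sum_congr rfl (fun y _ => this y), ← Finset.mul_sum]
  ring

/-- Jacobi sum of three characters with trivial product. -/
lemma jacobi3 {ψ : AddChar F ℂ} (hψ : ψ.IsPrimitive) {A B D : MulChar F ℂ} (hABD : A * B * D = 1)
    (hA : A ≠ 1) :
    gaussSum A ψ * gaussSum B ψ * gaussSum D ψ = -(Fintype.card F : ℂ) * jacobiS F ![A, B, D] := by
  let χ : Fin 3 → MulChar F ℂ := ![A, B, D]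
  let K : F → ℂ := fun s => ∑ v ∈ Finset.univ.filter (fun v : Fin 3 → F => ∑ i, v i = s),
    ∏ i, χ i (v i)
  have hK : ∀ s : F, s ≠ 0 → K s = jacobiS F ![A, B, D] := by
    intro s hs
    symm
    refine Finset.sum_bij' (fun v _ => fun i => s * v i) (fun v _ => fun i => s⁻¹ * v i) ?_ ?_ ?_ ?_ ?_
    · intro v hv
      simp only [Finset.mem_filter, Finset.mem_univ, true_and] at hv ⊢
      rw [← Finset.mul_sum, hv, mul_one]
    · intro v hv
      simp only [Finset.mem_filter, Finset.mem_univ, true_and] at hv ⊢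
      rw [← Finset.mul_sum, hv, inv_mul_cancel₀ hs]
    · intro v _; funext i; simp [hs]
    · intro v _; funext i; simp [hs]
    · intro v _
      have : A s * B s * D s = 1 := by
        rw [← MulChar.mul_apply, ← MulChar.mul_apply, hABD, MulChar.one_apply hs.isUnit]
      simp only [χ, Fin.prod_univ_three, map_mul, Matrix.cons_val_zero, Matrix.cons_val_one,
        Matrix.cons_val]
      linear_combination (-(A (v 0) * B (v 1) * D (v 2))) * this
  have hG : gaussSum A ψ * gaussSum B ψ * gaussSum D ψ = ∑ s, K s * ψ s := by
    have : gaussSum A ψ * gaussSum B ψ * gaussSum D ψ = ∏ i, ∑ x : F, χ i x * ψ x := by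
      rw [Fin.prod_univ_three]; rfl
    rw [this, Finset.prod_univ_sum, Fintype.piFinset_univ,
      ← Finset.sum_fiberwise (s := Finset.univ) (g := fun v : Fin 3 → F => ∑ i, v i)]
    refine Finset.sum_congr rfl fun s _ => ?_
    rw [Finset.sum_mul]
    refine Finset.sum_congr rfl fun v hv => ?_
    rw [← (Finset.mem_filter.mp hv).2, Finset.prod_mul_distrib]
    simp only [Fin.prod_univ_three, Fin.sum_univ_three, AddChar.map_add_eq_mul]
  have h0 : ∑ s, K s = 0 := by
    have : ∏ i, ∑ x : F, χ i x = 0 := by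
      apply Finset.prod_eq_zero (Finset.mem_univ 0)
      exact MulChar.sum_eq_zero_of_ne_one hA
    rw [Finset.prod_univ_sum, Fintype.piFinset_univ,
      ← Finset.sum_fiberwise (s := Finset.univ) (g := fun v : Fin 3 → F => ∑ i, v i)] at this
    exact this
  have hψ0 : ∑ s, ψ s = 0 := by
    apply AddChar.sum_eq_zero_of_ne_one
    have := hψ (a := 1) one_ne_zero
    simpa using this
  have hall : ∀ s : F, K s = jacobiS F ![A, B, D] + (if s = 0 then K 0 - jacobiS F ![A, B, D] else 0) := by
    intro s
    by_cases hs : s = 0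
    · simp [hs]
    · rw [hK s hs]; simp [hs]
  have hG2 : ∑ s, K s * ψ s = K 0 - jacobiS F ![A, B, D] := by
    rw [Finset.sum_congr rfl (fun s _ => by rw [hall s, add_mul]), Finset.sum_add_distrib,
      ← Finset.mul_sum, hψ0]
    simp
  have h02 : ∑ s, K s = Fintype.card F * jacobiS F ![A, B, D] + (K 0 - jacobiS F ![A, B, D]) := by
    rw [Finset.sum_congr rfl (fun s _ => hall s), Finset.sum_add_distrib]
    simp
  rw [hG, hG2]
  linear_combination h0 - h02

end mainsum

section assembly

set_option linter.unusedSectionVars false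

variable {F : Type} [Field F] [Fintype F]

/-- the product of six Gauss sums attached to the class `(0,0,1,3,3,5)` -/
noncomputable def sixProd (ψ : AddChar F ℂ) (θ φ χ : MulChar F ℂ) : ℂ :=
  gaussSum χ ψ * gaussSum χ ψ * gaussSum (χ * θ⁻¹ * φ) ψ * gaussSum (χ * φ) ψ *
    gaussSum (χ * φ) ψ * gaussSum (χ * θ * φ) ψ

/-- the reduced summand -/
noncomputable def redTerm (ψ : AddChar F ℂ) (θ φ χ : MulChar F ℂ) (L : F) : ℂ :=
  φ (-1) * gaussSum φ ψ * (gaussSum χ ψ * gaussSum (χ * φ) ψ * gaussSum (χ⁻¹ * θ) ψ *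
        gaussSum (χ⁻¹ * θ⁻¹) ψ * χ L)

lemma term_rel {ψ : AddChar F ℂ} (hψ : ψ.IsPrimitive) (h2 : (2 : F) ≠ 0) (h3 : (3 : F) ≠ 0)
    {θ φ : MulChar F ℂ} (h1 : θ ≠ 1) (hθ : θ ^ 3 = 1) (h1' : φ ≠ 1) (hφ : φ ^ 2 = 1)
    (χ : MulChar F ℂ) {lam : F} (hlam : lam ≠ 0) :
    sixProd ψ θ φ χ / gaussSum (χ ^ 6) ψ * (χ ^ 6) (6 * lam) *
      (gaussSum (χ * θ) ψ * gaussSum (χ * θ⁻¹) ψ) =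
    φ (-1) * (Fintype.card F : ℂ) ^ 2 * gaussSum φ ψ * gaussSum χ ψ * gaussSum (χ * φ) ψ *
      χ (lam ^ 6) := by
  have h := hd6 hψ h2 h3 h1 hθ h1' hφ χ
  have h6 : (6 : F) ≠ 0 := by
    have : (6 : F) = 2 * 3 := by norm_num
    rw [this]; exact mul_ne_zero h2 h3
  have hg := gs_ne_zero hψ (χ ^ 6)
  rw [chi_pow_app χ 6 (mul_ne_zero h6 hlam), map_mul, mul_pow, map_pow]
  unfold sixProd
  field_simp
  linear_combination (gaussSum χ ψ * gaussSum (χ * φ) ψ * χ lam ^ 6) * h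

lemma term_generic {ψ : AddChar F ℂ} (hψ : ψ.IsPrimitive) (h2 : (2 : F) ≠ 0) (h3 : (3 : F) ≠ 0)
    {θ φ : MulChar F ℂ} (h1 : θ ≠ 1) (hθ : θ ^ 3 = 1) (h1' : φ ≠ 1) (hφ : φ ^ 2 = 1)
    (χ : MulChar F ℂ) {lam : F} (hlam : lam ≠ 0) (c1 : χ * θ ≠ 1) (c2 : χ * θ⁻¹ ≠ 1) :
    sixProd ψ θ φ χ / gaussSum (χ ^ 6) ψ * (χ ^ 6) (6 * lam) = redTerm ψ θ φ χ (lam ^ 6) := by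
  have h := term_rel hψ h2 h3 h1 hθ h1' hφ χ hlam
  have d1 := gs_ne_zero hψ (χ * θ)
  have d2 := gs_ne_zero hψ (χ * θ⁻¹)
  have e1 := gs_inv hψ c1
  have e2 := gs_inv hψ c2
  rw [mul_inv] at e1 e2
  rw [inv_inv] at e2
  have n1 := chi_neg_one_sq χ
  have n2 := chi_neg_one_cubic hθ
  have n3 : θ⁻¹ (-1) = 1 := by rw [MulChar.inv_apply_eq_inv', n2, inv_one]
  rw [MulChar.mul_apply, n2, mul_one] at e1
  rw [MulChar.mul_apply, n3, mul_one] at e2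
  refine mul_right_cancel₀ (mul_ne_zero d1 d2) (h.trans ?_)
  have e3 : (gaussSum (χ * θ) ψ * gaussSum (χ⁻¹ * θ⁻¹) ψ) *
    (gaussSum (χ * θ⁻¹) ψ * gaussSum (χ⁻¹ * θ) ψ) = (Fintype.card F : ℂ) ^ 2 := by
    rw [e1, e2]; linear_combination ((Fintype.card F : ℂ) ^ 2) * n1
  unfold redTerm
  linear_combination (-(φ (-1) * gaussSum φ ψ * gaussSum χ ψ * gaussSum (χ * φ) ψ *
      χ (lam ^ 6))) * e3

lemma term_exc_aux {ψ : AddChar F ℂ} (hψ : ψ.IsPrimitive)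
    {θ : MulChar F ℂ} (hθ : θ ^ 3 = 1)
    (χ : MulChar F ℂ) (hχ : χ ^ 3 = 1)
    (c : (χ * θ = 1 ∧ χ * θ⁻¹ ≠ 1) ∨ (χ * θ ≠ 1 ∧ χ * θ⁻¹ = 1)) :
    (gaussSum (χ * θ) ψ * gaussSum (χ⁻¹ * θ⁻¹) ψ) *
    (gaussSum (χ * θ⁻¹) ψ * gaussSum (χ⁻¹ * θ) ψ) = (Fintype.card F : ℂ) := by
  have n1 := chi_neg_one_cubic hχ
  have n2 := chi_neg_one_cubic hθ
  have n3 : θ⁻¹ (-1) = 1 := by rw [MulChar.inv_apply_eq_inv', n2, inv_one]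
  have i1 : χ⁻¹ * θ⁻¹ = (χ * θ)⁻¹ := (mul_inv _ _).symm
  have i2 : χ⁻¹ * θ = (χ * θ⁻¹)⁻¹ := by rw [mul_inv, inv_inv]
  rw [i1, i2]
  rcases c with ⟨c1, c2⟩ | ⟨c1, c2⟩
  · rw [gs_inv hψ c2, c1, inv_one, gs_one hψ, MulChar.mul_apply, n1, n3]; ring
  · rw [gs_inv hψ c1, c2, inv_one, gs_one hψ, MulChar.mul_apply, n1, n2]; ring

lemma term_exc {ψ : AddChar F ℂ} (hψ : ψ.IsPrimitive) (h2 : (2 : F) ≠ 0) (h3 : (3 : F) ≠ 0)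
    {θ φ : MulChar F ℂ} (h1 : θ ≠ 1) (hθ : θ ^ 3 = 1) (h1' : φ ≠ 1) (hφ : φ ^ 2 = 1)
    (χ : MulChar F ℂ) {lam : F} (hlam : lam ≠ 0) (hχ : χ ^ 3 = 1)
    (c : (χ * θ = 1 ∧ χ * θ⁻¹ ≠ 1) ∨ (χ * θ ≠ 1 ∧ χ * θ⁻¹ = 1)) :
    sixProd ψ θ φ χ / gaussSum (χ ^ 6) ψ * (χ ^ 6) (6 * lam) =
      (Fintype.card F : ℂ) * redTerm ψ θ φ χ (lam ^ 6) ∧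
    sixProd ψ θ φ χ = -((Fintype.card F : ℂ) * redTerm ψ θ φ χ (lam ^ 6)) := by
  have h := term_rel hψ h2 h3 h1 hθ h1' hφ χ hlam
  have d1 := gs_ne_zero hψ (χ * θ)
  have d2 := gs_ne_zero hψ (χ * θ⁻¹)
  have e3 := term_exc_aux hψ hθ χ hχ c
  have key : sixProd ψ θ φ χ / gaussSum (χ ^ 6) ψ * (χ ^ 6) (6 * lam) =
      (Fintype.card F : ℂ) * redTerm ψ θ φ χ (lam ^ 6) := by
    refine mul_right_cancel₀ (mul_ne_zero d1 d2) (h.trans ?_)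
    unfold redTerm
    linear_combination (-(Fintype.card F : ℂ) * (φ (-1) * gaussSum φ ψ * gaussSum χ ψ *
      gaussSum (χ * φ) ψ * χ (lam ^ 6))) * e3
  refine ⟨key, ?_⟩
  have h6 : (6 : F) ≠ 0 := by
    have : (6 : F) = 2 * 3 := by norm_num
    rw [this]; exact mul_ne_zero h2 h3
  have hχ6 : χ ^ 6 = 1 := by
    rw [show 6 = 3 * 2 from rfl, pow_mul, hχ, one_pow]
  rw [← key, hχ6, gs_one hψ, MulChar.one_apply (mul_ne_zero h6 hlam).isUnit]
  ring

lemma orderOf_gen {ω : MulChar F ℂ} (hω : ∀ χ : MulChar F ℂ, ∃ j : ℕ, χ = ω ^ j) :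
    orderOf ω = Fintype.card F - 1 := by
  have hc : Nat.card (MulChar F ℂ) = Nat.card Fˣ :=
    MulChar.card_eq_card_units_of_hasEnoughRootsOfUnity F ℂ
  rw [orderOf_eq_card_of_forall_mem_zpowers (g := ω), hc, Nat.card_eq_fintype_card,
    Fintype.card_units]
  intro χ
  obtain ⟨j, rfl⟩ := hω χ
  exact Subgroup.npow_mem_zpowers ω j

lemma cast_ne_zero_of (p e q : ℕ) [Fact p.Prime] [Algebra (ZMod p) F] (hqe : q = p ^ e)
    (he : 0 < e) (hmod : q % 6 = 1) : (2 : F) ≠ 0 ∧ (3 : F) ≠ 0 := by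
  have hp : p.Prime := Fact.out
  have : CharP F p := charP_of_injective_algebraMap (algebraMap (ZMod p) F).injective p
  have hpq : p ∣ q := by rw [hqe]; exact dvd_pow_self p he.ne'
  constructor
  · intro h
    have : p ∣ 2 := (CharP.cast_eq_zero_iff F p 2).mp (by exact_mod_cast h)
    have := (Nat.prime_dvd_prime_iff_eq hp Nat.prime_two).mp this
    rw [this] at hpq
    omega
  · intro h
    have : p ∣ 3 := (CharP.cast_eq_zero_iff F p 3).mp (by exact_mod_cast h)
    have := (Nat.prime_dvd_prime_iff_eq hp Nat.prime_three).mp this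
    rw [this] at hpq
    omega

/-- Sum over all `j`, separating the two exceptional indices. -/
lemma sum_terms {ψ : AddChar F ℂ} (hψ : ψ.IsPrimitive) (h2 : (2 : F) ≠ 0) (h3 : (3 : F) ≠ 0)
    {ω : MulChar F ℂ} {t : ℕ} (ht : 0 < t) (hord : orderOf ω = 6 * t)
    {lam : F} (hlam : lam ≠ 0) :
    let θ := ω ^ (2 * t)
    let φ := ω ^ (3 * t)
    (∑ j ∈ Finset.range (6 * t), sixProd ψ θ φ (ω ^ j) / gaussSum ((ω ^ j) ^ 6) ψ *
        ((ω ^ j) ^ 6) (6 * lam)) =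
      (∑ j ∈ Finset.range (6 * t), redTerm ψ θ φ (ω ^ j) (lam ^ 6)) +
      ((Fintype.card F : ℂ) - 1) * (redTerm ψ θ φ (ω ^ (2 * t)) (lam ^ 6) +
        redTerm ψ θ φ (ω ^ (4 * t)) (lam ^ 6)) ∧
    sixProd ψ θ φ (ω ^ (2 * t)) + sixProd ψ θ φ (ω ^ (4 * t)) =
      -((Fintype.card F : ℂ) * (redTerm ψ θ φ (ω ^ (2 * t)) (lam ^ 6) +
        redTerm ψ θ φ (ω ^ (4 * t)) (lam ^ 6))) := by
  intro θ φ
  have hone : ω ^ (6 * t) = 1 := by rw [← hord]; exact pow_orderOf_eq_one ω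
  have hne : ∀ n, 0 < n → n < 6 * t → ω ^ n ≠ 1 := by
    intro n h0 hn h
    have := Nat.le_of_dvd h0 (orderOf_dvd_of_pow_eq_one h)
    omega
  have h1 : θ ≠ 1 := hne _ (by omega) (by omega)
  have h1' : φ ≠ 1 := hne _ (by omega) (by omega)
  have hθ : θ ^ 3 = 1 := by
    rw [← pow_mul, show 2 * t * 3 = 6 * t by ring, hone]
  have hφ : φ ^ 2 = 1 := by
    rw [← pow_mul, show 3 * t * 2 = 6 * t by ring, hone]
  have hinv : θ⁻¹ = ω ^ (4 * t) := by
    rw [inv_eq_iff_mul_eq_one, ← pow_add, show 2 * t + 4 * t = 6 * t by ring, hone]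
  have hθθ : θ * θ ≠ 1 := by
    rw [← pow_add]; exact hne _ (by omega) (by omega)
  have x2 := term_exc hψ h2 h3 h1 hθ h1' hφ (ω ^ (2 * t)) hlam hθ
    (Or.inr ⟨hθθ, mul_inv_cancel θ⟩)
  have x4 := term_exc hψ h2 h3 h1 hθ h1' hφ (ω ^ (4 * t)) hlam
    (by rw [← hinv, inv_pow, hθ, inv_one])
    (Or.inl (by
      rw [← hinv]
      refine ⟨inv_mul_cancel θ, fun h => hθθ ?_⟩
      rw [← mul_inv, inv_eq_one] at h
      exact h))
  refine ⟨?_, by linear_combination x2.2 + x4.2⟩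
  have hterm : ∀ j ∈ Finset.range (6 * t),
      sixProd ψ θ φ (ω ^ j) / gaussSum ((ω ^ j) ^ 6) ψ * ((ω ^ j) ^ 6) (6 * lam) =
      redTerm ψ θ φ (ω ^ j) (lam ^ 6) +
      ((if j = 2 * t then ((Fintype.card F : ℂ) - 1) * redTerm ψ θ φ (ω ^ (2 * t)) (lam ^ 6) else 0) +
       (if j = 4 * t then ((Fintype.card F : ℂ) - 1) * redTerm ψ θ φ (ω ^ (4 * t)) (lam ^ 6)
        else 0)) := by
    intro j hj
    have hj := Finset.mem_range.mp hj
    by_cases j2 : j = 2 * t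
    · subst j2
      rw [if_pos rfl, if_neg (by omega), x2.1]; ring
    by_cases j4 : j = 4 * t
    · subst j4
      rw [if_pos rfl, if_neg (by omega), x4.1]; ring
    rw [if_neg j2, if_neg j4, add_zero, add_zero]
    have inj : ∀ a b : ℕ, a < 6 * t → b < 6 * t → ω ^ a = ω ^ b → a = b := by
      intro a b ha hb hab
      exact pow_injOn_Iio_orderOf (by simpa [hord] using ha) (by simpa [hord] using hb) hab
    apply term_generic hψ h2 h3 h1 hθ h1' hφ _ hlam
    · intro h
      rw [mul_eq_one_iff_eq_inv, hinv] at h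
      exact j4 (inj _ _ hj (by omega) h)
    · intro h
      rw [mul_inv_eq_one] at h
      exact j2 (inj _ _ hj (by omega) h)
  rw [Finset.sum_congr rfl hterm, Finset.sum_add_distrib, Finset.sum_add_distrib,
    Finset.sum_ite_eq', Finset.sum_ite_eq', if_pos (Finset.mem_range.mpr (by omega)),
    if_pos (Finset.mem_range.mpr (by omega))]
  ring

end assembly

/-- The contribution of the class of `w = (0,0,1,3,3,5)` in Koblitz's formula. -/
theorem class_001335 (p e q t : ℕ) [Fact p.Prime] (F : Type) [Field F] [Fintype F]
    [Algebra (ZMod p) F]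
    (he : 0 < e) (hq : q = Fintype.card F) (hqe : q = p ^ e) (hmod : q % 6 = 1)
    (ht : t = (q - 1) / 6)
    (ω : MulChar F ℂ) (hω : ∀ χ : MulChar F ℂ, ∃ j : ℕ, χ = ω ^ j)
    (ω₆ ω₃ ω₂ : MulChar F ℂ)
    (hω₆ : ω₆ = ω ^ t) (hω₃ : ω₃ = ω ^ (2 * t)) (hω₂ : ω₂ = ω ^ (3 * t))
    (lam : F) (hlam : lam ≠ 0) (hlam6 : lam ^ 6 ≠ 1) :
    (∑ k ∈ Finset.range 6, NqW p F ω 6 (fun i => (![0,0,1,3,3,5] : Fin 6 → ZMod 6) i + (k : ZMod 6))) +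
      SW p F ω 6 (fun _ => 1) (![0,0,1,3,3,5] : Fin 6 → ZMod 6) lam =
      -((q : ℂ) ^ 2) * jacobiS F ![ω₆, ω₃, ω₂] * greene2F1 F ω₃ ω₃⁻¹ ω₂ (lam ^ 6)⁻¹ := by
  subst hq
  obtain ⟨h2, h3⟩ := cast_ne_zero_of (F := F) p e _ hqe he hmod
  have hgt : 1 < Fintype.card F := Fintype.one_lt_card
  have hcard : Fintype.card F - 1 = 6 * t := by omega
  have ht0 : 0 < t := by omega
  have hord : orderOf ω = 6 * t := by rw [orderOf_gen hω, hcard]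
  have hone : ω ^ (6 * t) = 1 := by rw [← hord]; exact pow_orderOf_eq_one ω
  have hne : ∀ n, 0 < n → n < 6 * t → ω ^ n ≠ 1 := by
    intro n h0 hn h
    have := Nat.le_of_dvd h0 (orderOf_dvd_of_pow_eq_one h)
    omega
  have hψ := trChar_primitive (F := F) p
  have hL : lam ^ 6 ≠ 0 := pow_ne_zero 6 hlam
  have h1 : ω₃ ≠ 1 := by rw [hω₃]; exact hne _ (by omega) (by omega)
  have h1' : ω₂ ≠ 1 := by rw [hω₂]; exact hne _ (by omega) (by omega)
  have h16 : ω₆ ≠ 1 := by rw [hω₆]; exact hne _ (by omega) (by omega)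
  have hθ : ω₃ ^ 3 = 1 := by
    rw [hω₃, ← pow_mul, show 2 * t * 3 = 6 * t by ring, hone]
  have hφ : ω₂ ^ 2 = 1 := by
    rw [hω₂, ← pow_mul, show 3 * t * 2 = 6 * t by ring, hone]
  have hinv : ω₃⁻¹ = ω ^ (4 * t) := by
    rw [inv_eq_iff_mul_eq_one, hω₃, ← pow_add, show 2 * t + 4 * t = 6 * t by ring, hone]
  have h6 : ω₂ * ω₃⁻¹ = ω₆ := by
    rw [mul_inv_eq_iff_eq_mul, hω₂, hω₃, hω₆, ← pow_add]; congr 1; ring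
  have hθL : ω₃ (lam ^ 6) = 1 := by
    rw [map_pow, show 6 = 3 * 2 from rfl, pow_mul, chi_unit_pow hθ hlam, one_pow]
  have hq0 : (Fintype.card F : ℂ) ≠ 0 := by
    exact_mod_cast (show Fintype.card F ≠ 0 by omega)
  have hq1 : (Fintype.card F : ℂ) - 1 ≠ 0 := by
    intro h
    have h' : (Fintype.card F : ℂ) = (1 : ℕ) := by
      rw [Nat.cast_one]; linear_combination h
    have := Nat.cast_injective h'
    omega
  -- the three kinds of shifted characters
  have s6 : ∀ a b : ℕ, a = b + 6 * t → ω ^ a = ω ^ b := by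
    intro a b h
    rw [h, pow_add, hone, mul_one]
  have sx1 : ∀ j, ω ^ j * ω₃⁻¹ * ω₂ = ω ^ (1 * t + j) := by
    intro j
    rw [hinv, hω₂, ← pow_add, ← pow_add]
    exact s6 _ _ (by ring)
  have sx3 : ∀ j, ω ^ j * ω₂ = ω ^ (3 * t + j) := by
    intro j
    rw [hω₂, ← pow_add]; congr 1; ring
  have sx5 : ∀ j, ω ^ j * ω₃ * ω₂ = ω ^ (5 * t + j) := by
    intro j
    rw [hω₂, hω₃, ← pow_add, ← pow_add]; congr 1; ring
  have hsix : ∀ j, sixProd (trChar p F) ω₃ ω₂ (ω ^ j) =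
      gaussSum (ω ^ j) (trChar p F) * gaussSum (ω ^ j) (trChar p F) *
      gaussSum (ω ^ (1 * t + j)) (trChar p F) * gaussSum (ω ^ (3 * t + j)) (trChar p F) *
      gaussSum (ω ^ (3 * t + j)) (trChar p F) * gaussSum (ω ^ (5 * t + j)) (trChar p F) := by
    intro j
    unfold sixProd
    rw [sx1, sx3, sx5]
  have hS : SW p F ω 6 (fun _ => 1) (![0,0,1,3,3,5] : Fin 6 → ZMod 6) lam =
      ((Fintype.card F : ℂ) - 1)⁻¹ * ∑ j ∈ Finset.range (6 * t),
        sixProd (trChar p F) ω₃ ω₂ (ω ^ j) / gaussSum ((ω ^ j) ^ 6) (trChar p F) *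
        ((ω ^ j) ^ 6) (6 * lam) := by
    unfold SW
    simp only [gaussChar_eq]
    rw [← ht, hcard]
    congr 1
    refine Finset.sum_congr rfl fun j _ => ?_
    rw [hsix, ← pow_mul, mul_comm j 6, Fin.prod_univ_six]
    have v0 : ω ^ (0 * t + 1 * j) = ω ^ j := by rw [zero_mul, zero_add, one_mul]
    have hc : ((6 : ℕ) : F) = 6 := by norm_cast
    change gaussSum (ω ^ (0 * t + 1 * j)) _ * gaussSum (ω ^ (0 * t + 1 * j)) _ *
      gaussSum (ω ^ (1 * t + 1 * j)) _ * gaussSum (ω ^ (3 * t + 1 * j)) _ *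
      gaussSum (ω ^ (3 * t + 1 * j)) _ * gaussSum (ω ^ (5 * t + 1 * j)) _ / _ * _ = _
    rw [v0, one_mul j, hc]
  have hN : (∑ k ∈ Finset.range 6,
      NqW p F ω 6 (fun i => (![0,0,1,3,3,5] : Fin 6 → ZMod 6) i + (k : ZMod 6))) =
      (1 / (Fintype.card F : ℂ)) * (sixProd (trChar p F) ω₃ ω₂ (ω ^ (2 * t)) +
        sixProd (trChar p F) ω₃ ω₂ (ω ^ (4 * t))) := by
    have n0 : ∀ k ∈ ({0, 1, 3, 5} : Finset ℕ), NqW p F ω 6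
        (fun i => (![0,0,1,3,3,5] : Fin 6 → ZMod 6) i + (k : ZMod 6)) = 0 := by
      intro k hk
      unfold NqW
      rw [if_neg, if_neg]
      · revert k; decide
      · revert k; decide
    have n2 : NqW p F ω 6 (fun i => (![0,0,1,3,3,5] : Fin 6 → ZMod 6) i + ((2 : ℕ) : ZMod 6)) =
        (1 / (Fintype.card F : ℂ)) * sixProd (trChar p F) ω₃ ω₂ (ω ^ (2 * t)) := by
      unfold NqW
      rw [if_neg (by decide), if_pos (by decide), hsix]
      simp only [gaussChar_eq]
      rw [← ht, Fin.prod_univ_six]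
      congr 1
      change gaussSum (ω ^ (2 * t)) _ * gaussSum (ω ^ (2 * t)) _ *
        gaussSum (ω ^ (3 * t)) _ * gaussSum (ω ^ (5 * t)) _ *
        gaussSum (ω ^ (5 * t)) _ * gaussSum (ω ^ (1 * t)) _ = _
      rw [show 1 * t + 2 * t = 3 * t by ring, show 3 * t + 2 * t = 5 * t by ring,
        s6 (5 * t + 2 * t) (1 * t) (by ring)]
    have n4 : NqW p F ω 6 (fun i => (![0,0,1,3,3,5] : Fin 6 → ZMod 6) i + ((4 : ℕ) : ZMod 6)) =
        (1 / (Fintype.card F : ℂ)) * sixProd (trChar p F) ω₃ ω₂ (ω ^ (4 * t)) := by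
      unfold NqW
      rw [if_neg (by decide), if_pos (by decide), hsix]
      simp only [gaussChar_eq]
      rw [← ht, Fin.prod_univ_six]
      congr 1
      change gaussSum (ω ^ (4 * t)) _ * gaussSum (ω ^ (4 * t)) _ *
        gaussSum (ω ^ (5 * t)) _ * gaussSum (ω ^ (1 * t)) _ *
        gaussSum (ω ^ (1 * t)) _ * gaussSum (ω ^ (3 * t)) _ = _
      rw [show 1 * t + 4 * t = 5 * t by ring, s6 (3 * t + 4 * t) (1 * t) (by ring),
        s6 (5 * t + 4 * t) (3 * t) (by ring)]
    simp only [Finset.sum_range_succ, Finset.sum_range_zero]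
    rw [n0 0 (by decide), n0 1 (by decide), n2, n0 3 (by decide), n4, n0 5 (by decide)]
    ring
  have hT := sum_terms hψ h2 h3 ht0 hord hlam
  dsimp only at hT
  rw [← hω₃, ← hω₂] at hT
  have hM := main_sum (ψ := trChar p F) hω h1 (by rw [h6]; exact h16) hL hθL
  rw [← greene_sum hθ hφ hL hθL, hcard, h6] at hM
  have hJ := jacobi3 (A := ω₆) (B := ω₃) (D := ω₂) hψ (by
    rw [hω₆, hω₃, hω₂, ← pow_add, ← pow_add, ← hone]; congr 1; ring) h16
  have hB : ∑ j ∈ Finset.range (6 * t), redTerm (trChar p F) ω₃ ω₂ (ω ^ j) (lam ^ 6) =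
      ω₂ (-1) * gaussSum ω₂ (trChar p F) * (((Fintype.card F : ℂ) - 1) *
        gaussSum ω₃ (trChar p F) * gaussSum ω₆ (trChar p F) *
        ∑ y : F, ω₃⁻¹ y * ((ω₃⁻¹)⁻¹ * ω₂) (1 - y) * ω₃⁻¹ (1 - (lam ^ 6)⁻¹ * y)) := by
    rw [← hM, Finset.mul_sum]
    rfl
  have n3 : ω₃⁻¹ (-1) = 1 := by
    rw [MulChar.inv_apply_eq_inv', chi_neg_one_cubic hθ, inv_one]
  rw [← hω₃] at hN
  rw [hN, hS]
  rw [hT.2, hT.1, hB]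
  unfold greene2F1
  rw [MulChar.one_apply (inv_ne_zero hL).isUnit, MulChar.mul_apply, n3]
  generalize (∑ y : F, ω₃⁻¹ y * ((ω₃⁻¹)⁻¹ * ω₂) (1 - y) * ω₃⁻¹ (1 - (lam ^ 6)⁻¹ * y)) = T
  generalize redTerm (trChar p F) ω₃ ω₂ ω₃ (lam ^ 6) = X at *
  generalize redTerm (trChar p F) ω₃ ω₂ (ω ^ (4 * t)) (lam ^ 6) = Y at *
  have hJ' : jacobiS F ![ω₆, ω₃, ω₂] = -(gaussSum ω₆ (trChar p F) * gaussSum ω₃ (trChar p F) *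
      gaussSum ω₂ (trChar p F)) / (Fintype.card F : ℂ) := by
    rw [hJ]; field_simp
  rw [hJ']
  field_simp
  ring
end
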